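/- Let k be an algebraically closed field, Q a strongly locally finite quiver, and M an indecomposable representation in rep(Q) that is neither finitely presented nor finitely co-presented. Then: (i) if N₁ and N₂ are indecomposable representations in rep(Q) admitting irreducible morphisms M → N₁ and M → N₂, then N₁ ≅ N₂; and (ii) for any indecomposable representation N there is no irreducible morphism M → N ⊕ N. -/

import Mathlib

open CategoryTheory CategoryTheory.Limits

namespace Paper

variable (k : Type) [Field k]

section General

variable (A : Type) [Category.{0} A] [Preadditive A] [CategoryTheory.Linear k A]

/-- A spectroid over `k`: a (small) Hom-finite `k`-linear category in which every object
has a local endomorphism ring and distinct objects are not isomorphic. -/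
class Spectroid : Prop where
  homFinite : ∀ a b : A, FiniteDimensional k (a ⟶ b)
  localEnd : ∀ a : A, IsLocalRing (End a)
  skeletal : ∀ a b : A, (a ≅ b) → a = b

variable {A}

/-- `M` is a module over `A`, i.e. the functor `M : A ⥤ ModuleCat k` is additive and
`k`-linear on morphisms. -/
def IsMod (M : A ⥤ ModuleCat.{0} k) : Prop :=
  (∀ {a b : A} (f g : a ⟶ b), M.map (f + g) = M.map f + M.map g) ∧
  (∀ {a b : A} (r : k) (f : a ⟶ b), M.map (r • f) = r • M.map f)

/-- `M` is a locally finite dimensional module over `A`, i.e. an object of `mod A`. -/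
def IsLfdMod (M : A ⥤ ModuleCat.{0} k) : Prop :=
  IsMod k M ∧ ∀ a : A, FiniteDimensional k (M.obj a)

/-- The projective module `P_a = Hom_A(a, -)` at an object `a`. -/
noncomputable def ProjAt (a : A) : A ⥤ ModuleCat.{0} k :=
  (linearCoyoneda k A).obj (Opposite.op a)

/-- The injective module `I_a = D Hom_A(-, a)` at an object `a`. -/
noncomputable def InjAt (a : A) : A ⥤ ModuleCat.{0} k where
  obj b := ModuleCat.of k (Module.Dual k (b ⟶ a))
  map {b c} f := ModuleCat.ofHom (LinearMap.dualMap (Linear.leftComp k a f))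
  map_id b := by
    have h : Linear.leftComp k a (𝟙 b) = LinearMap.id := by
      apply LinearMap.ext; intro g; simp
    rw [h, LinearMap.dualMap_id]; rfl
  map_comp {b c d} f g := by
    have h : Linear.leftComp k a (f ≫ g) =
        (Linear.leftComp k a f).comp (Linear.leftComp k a g) := by
      apply LinearMap.ext; intro h; simp
    rw [h]; rfl

instance : HasFiniteBiproducts (A ⥤ ModuleCat.{0} k) :=
  CategoryTheory.Abelian.hasFiniteBiproducts

/-- `M` is finitely generated: there is an epimorphism `⊕_{i=1}^r P_{a_i} → M`. -/
def IsFG (M : A ⥤ ModuleCat.{0} k) : Prop :=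
  ∃ (r : ℕ) (a : Fin r → A) (f : (⨁ fun i => ProjAt k (a i)) ⟶ M), Epi f

/-- `M` is finitely presented: there is an epimorphism `⊕_{i=1}^r P_{a_i} → M` with
finitely generated kernel. -/
def IsFP (M : A ⥤ ModuleCat.{0} k) : Prop :=
  ∃ (r : ℕ) (a : Fin r → A) (f : (⨁ fun i => ProjAt k (a i)) ⟶ M),
    Epi f ∧ IsFG k (kernel f)

/-- `M` is finitely co-generated: there is a monomorphism `M → ⊕_{j=1}^s I_{b_j}`. -/
def IsFCG (M : A ⥤ ModuleCat.{0} k) : Prop :=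
  ∃ (s : ℕ) (b : Fin s → A) (f : M ⟶ ⨁ fun j => InjAt k (b j)), Mono f

/-- `M` is finitely co-presented: there is a monomorphism `M → ⊕_{j=1}^s I_{b_j}` with
finitely co-generated cokernel. -/
def IsFCP (M : A ⥤ ModuleCat.{0} k) : Prop :=
  ∃ (s : ℕ) (b : Fin s → A) (f : M ⟶ ⨁ fun j => InjAt k (b j)),
    Mono f ∧ IsFCG k (cokernel f)

/-- `f` is an irreducible morphism in `mod A`: it is neither a split mono nor a split epi,
and in any factorization `f = g ≫ h` through an object of `mod A`, `g` is a split mono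
or `h` is a split epi. -/
def Irred {L M : A ⥤ ModuleCat.{0} k} (f : L ⟶ M) : Prop :=
  ¬ IsSplitMono f ∧ ¬ IsSplitEpi f ∧
    ∀ ⦃X : A ⥤ ModuleCat.{0} k⦄, IsLfdMod k X →
      ∀ (g : L ⟶ X) (h : X ⟶ M), g ≫ h = f → IsSplitMono g ∨ IsSplitEpi h

/-- `M` is an indecomposable object of `mod A`: it is nonzero, and whenever `M ≅ X ⊞ Y`
with `X`, `Y` in `mod A`, one of `X`, `Y` is zero. -/
def Indec (M : A ⥤ ModuleCat.{0} k) : Prop :=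
  ¬ IsZero M ∧ ∀ ⦃X Y : A ⥤ ModuleCat.{0} k⦄, IsLfdMod k X → IsLfdMod k Y →
    (M ≅ X ⊞ Y) → IsZero X ∨ IsZero Y

/-- `0 → L →f M →g N → 0` is an almost split sequence in `mod A`. -/
structure AlmostSplitSeq {L M N : A ⥤ ModuleCat.{0} k} (f : L ⟶ M) (g : M ⟶ N) : Prop where
  mono : Mono f
  epi : Epi g
  zero : f ≫ g = 0
  exact : (ShortComplex.mk f g zero).Exact
  not_splitMono : ¬ IsSplitMono f
  not_splitEpi : ¬ IsSplitEpi g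
  left_almost_split : ∀ ⦃X : A ⥤ ModuleCat.{0} k⦄, IsLfdMod k X →
    ∀ u : L ⟶ X, ¬ IsSplitMono u → ∃ v : M ⟶ X, f ≫ v = u
  right_almost_split : ∀ ⦃X : A ⥤ ModuleCat.{0} k⦄, IsLfdMod k X →
    ∀ u : X ⟶ N, ¬ IsSplitEpi u → ∃ v : X ⟶ M, v ≫ g = u

/-- `M` is projective as an object of `mod A`. -/
def ProjInMod (M : A ⥤ ModuleCat.{0} k) : Prop :=
  ∀ ⦃X Y : A ⥤ ModuleCat.{0} k⦄, IsLfdMod k X → IsLfdMod k Y →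
    ∀ (e : X ⟶ Y), Epi e → ∀ u : M ⟶ Y, ∃ t : M ⟶ X, t ≫ e = u

/-- `M` is injective as an object of `mod A`. -/
def InjInMod (M : A ⥤ ModuleCat.{0} k) : Prop :=
  ∀ ⦃X Y : A ⥤ ModuleCat.{0} k⦄, IsLfdMod k X → IsLfdMod k Y →
    ∀ (m : X ⟶ Y), Mono m → ∀ u : X ⟶ M, ∃ t : Y ⟶ M, m ≫ t = u

/-- `h` is a (nonempty) composition of irreducible morphisms between indecomposable
objects of `mod A`. -/
inductive IrredChain : ∀ {X Y : A ⥤ ModuleCat.{0} k}, (X ⟶ Y) → Prop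
  | single {X Y : A ⥤ ModuleCat.{0} k} (f : X ⟶ Y) :
      IsLfdMod k X → Indec k X → IsLfdMod k Y → Indec k Y → Irred k f → IrredChain f
  | comp {X Y Z : A ⥤ ModuleCat.{0} k} (f : X ⟶ Y) (g : Y ⟶ Z) :
      IsLfdMod k X → Indec k X → Irred k f → IrredChain g → IrredChain (f ≫ g)

end General

section QuiverSection

variable (Q : Type) [Quiver.{0} Q]

/-- `Q` is locally finite: every vertex is the source of finitely many arrows and the
target of finitely many arrows. -/
def LocallyFinite : Prop :=
  ∀ x : Q, Finite (Σ y : Q, x ⟶ y) ∧ Finite (Σ y : Q, y ⟶ x)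

/-- `Q` is interval finite: there are finitely many paths between any two vertices. -/
def IntervalFinite : Prop :=
  ∀ x y : Q, Finite (Quiver.Path x y)

/-- `Q` is strongly locally finite: locally finite and interval finite. -/
def StronglyLocallyFinite : Prop :=
  LocallyFinite Q ∧ IntervalFinite Q

/-- `Q` is connected: nonempty, and any two vertices are joined by a walk. -/
def QuiverConnected : Prop :=
  Nonempty Q ∧ ∀ x y : Q,
    Nonempty (Quiver.Path (Quiver.Symmetrify.of.obj x) (Quiver.Symmetrify.of.obj y))

/-- The path category `kQ` of the quiver `Q`: the free `k`-linear category on the free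
category on `Q`. -/
abbrev PathCat := CategoryTheory.Free k (Paths Q)

/-- A vertex of `Q`, seen as an object of the path category `kQ`. -/
noncomputable def vtx (x : Q) : PathCat k Q :=
  (Free.embedding k (Paths Q)).obj ((Paths.of Q).obj x)

/-- An arrow of `Q`, seen as a morphism of the path category `kQ`. -/
noncomputable def arrHom {x y : Q} (α : x ⟶ y) : vtx k Q x ⟶ vtx k Q y :=
  (Free.embedding k (Paths Q)).map ((Paths.of Q).map α)

/-- The degree of a vertex of `Q`: the total number of arrows incident to it. -/
noncomputable def degree (x : Q) : ℕ :=
  Nat.card ((Σ y : Q, x ⟶ y) ⊕ (Σ y : Q, y ⟶ x))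

/-- `M` belongs to `rrep(Q)`: it is the middle term of a short exact sequence
`0 → L → M → N → 0` with `L` finitely presented, `N` finitely co-presented, and only
finitely many arrows `α` of `Q` satisfy `M(α) ≠ 0`, `L(α) = 0` and `N(α) = 0`. -/
def InRrep (M : PathCat k Q ⥤ ModuleCat.{0} k) : Prop :=
  ∃ (L N : PathCat k Q ⥤ ModuleCat.{0} k) (f : L ⟶ M) (g : M ⟶ N) (zero : f ≫ g = 0),
    Mono f ∧ Epi g ∧ (ShortComplex.mk f g zero).Exact ∧ IsFP k L ∧ IsFCP k N ∧
    Set.Finite {p : Σ (x : Q) (y : Q), x ⟶ y |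
      M.map (arrHom k Q p.2.2) ≠ 0 ∧ L.map (arrHom k Q p.2.2) = 0 ∧
      N.map (arrHom k Q p.2.2) = 0}

variable {Q}

/-- The vertices occurring in a path. -/
def InPath {x : Q} : ∀ {y : Q}, Quiver.Path x y → Q → Prop
  | _, Quiver.Path.nil, v => v = x
  | _, @Quiver.Path.cons _ _ _ _ c p _, v => v = c ∨ InPath p v

variable (Q)

/-- `Q` is a star quiver: it is obtained from a finite full convex subquiver `Γ` by
attaching finitely many rays and co-rays with no common vertices. -/
def IsStarQuiver : Prop :=
  ∃ (Γ S₁ S₂ : Set Q) (v : Q → ℕ → Q),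
    Γ.Finite ∧ S₁ ⊆ Γ ∧ S₂ ⊆ Γ ∧ Disjoint S₁ S₂ ∧
    (∀ x y : Q, x ∈ Γ → y ∈ Γ → ∀ p : Quiver.Path x y, ∀ z : Q, InPath p z → z ∈ Γ) ∧
    (∀ s ∈ S₁ ∪ S₂, ∀ i : ℕ, v s i ∉ Γ) ∧
    (∀ s ∈ S₁ ∪ S₂, ∀ t ∈ S₁ ∪ S₂, ∀ i j : ℕ, v s i = v t j → s = t ∧ i = j) ∧
    (∀ x : Q, x ∉ Γ → ∃ s ∈ S₁ ∪ S₂, ∃ i : ℕ, x = v s i) ∧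
    (∀ s ∈ S₁, Nat.card (s ⟶ v s 0) = 1 ∧ ∀ i : ℕ, Nat.card (v s i ⟶ v s (i + 1)) = 1) ∧
    (∀ s ∈ S₂, Nat.card (v s 0 ⟶ s) = 1 ∧ ∀ i : ℕ, Nat.card (v s (i + 1) ⟶ v s i) = 1) ∧
    (∀ x y : Q, (x ⟶ y) → ¬(x ∈ Γ ∧ y ∈ Γ) →
      (∃ s ∈ S₁, (x = s ∧ y = v s 0) ∨ ∃ i : ℕ, x = v s i ∧ y = v s (i + 1)) ∨
      (∃ s ∈ S₂, (x = v s 0 ∧ y = s) ∨ ∃ i : ℕ, x = v s (i + 1) ∧ y = v s i))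

end QuiverSection

section Paths

variable {V : Type}

/-- Paths in the quiver with vertex set `V` and arrows `H`. -/
inductive Pth (H : V → V → Type) (a : V) : V → Type
  | nil : Pth H a a
  | cons {b c : V} (p : Pth H a b) (α : H b c) : Pth H a c

/-- The opposite of the quiver with arrows `H`. -/
abbrev Opp (H : V → V → Type) : V → V → Type := fun x y => H y x

namespace Pth

variable {H : V → V → Type}

/-- The length of a path. -/
def length {a : V} : ∀ {b : V}, Pth H a b → ℕ
  | _, nil => 0
  | _, cons p _ => p.length + 1

/-- Concatenation of paths. -/
def append {a b : V} (p : Pth H a b) : ∀ {c : V}, Pth H b c → Pth H a c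
  | _, nil => p
  | _, cons q α => (append p q).cons α

theorem length_append {a b : V} (p : Pth H a b) {c : V} (q : Pth H b c) :
    (p.append q).length = p.length + q.length := by
  induction q with
  | nil => rfl
  | cons q α ih => simp only [append, length, ih, Nat.add_assoc]

/-- A path preceded by an arrow. -/
def pre {a b : V} (α : H a b) {c : V} (q : Pth H b c) : Pth H a c :=
  (cons nil α).append q

/-- The reverse of a path, in the opposite quiver. -/
def rev {a : V} : ∀ {b : V}, Pth H a b → Pth (Opp H) b a
  | _, nil => nil
  | _, cons p α => pre (H := Opp H) α p.rev

theorem rev_pre {a b : V} (α : H a b) {c : V} (q : Pth H b c) :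
    (pre α q).rev = cons (H := Opp H) q.rev α := by
  induction q with
  | nil => rfl
  | cons q β ih =>
    change pre (H := Opp H) β (pre α q).rev = _
    rw [ih]; rfl

theorem rev_rev {a b : V} (p : Pth H a b) : rev (H := Opp H) p.rev = p := by
  induction p with
  | nil => rfl
  | cons p α ih =>
    change rev (H := Opp H) (pre (H := Opp H) α p.rev) = _
    rw [rev_pre (H := Opp H), ih]

/-- Reversal is a bijection from paths to paths in the opposite quiver. -/
def revEquiv (a b : V) : Pth H a b ≃ Pth (Opp H) b a where
  toFun := rev
  invFun := rev (H := Opp H)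
  left_inv := rev_rev
  right_inv := rev_rev (H := Opp H)

/-- The set of vertices of a path. -/
def verts {a : V} : ∀ {b : V}, Pth H a b → Set V
  | _, nil => {a}
  | _, @cons _ _ _ _ c p _ => insert c p.verts

theorem finite_verts {a b : V} (p : Pth H a b) : p.verts.Finite := by
  induction p with
  | nil => exact Set.finite_singleton _
  | cons p α ih => exact ih.insert _

theorem mem_verts_append {a b : V} (p : Pth H a b) {c : V} (q : Pth H b c) :
    b ∈ (p.append q).verts := by
  induction q with
  | nil => cases p <;> simp [append, verts]
  | cons q α ih => exact Set.mem_insert_of_mem _ ih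

end Pth

/-- The quiver with arrows `H` is strongly locally finite. -/
class SLF (H : V → V → Type) : Prop where
  out : ∀ x, Finite (Σ y, H x y)
  inn : ∀ x, Finite (Σ y, H y x)
  path : ∀ x y, Finite (Pth H x y)

variable (H : V → V → Type)

instance [h : SLF H] : SLF (Opp H) where
  out := h.inn
  inn := h.out
  path x y := by
    have := h.path y x
    exact Finite.of_equiv _ (Pth.revEquiv y x)

instance [h : SLF H] (x y : V) : Finite (Pth H x y) := h.path x y

noncomputable instance [h : SLF H] (x : V) : Fintype (Σ y, H y x) :=
  have := h.inn x
  Fintype.ofFinite _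

/-- The vertices that can be reached from a vertex in `S`. -/
def Succs (S : Set V) : Set V := {x | ∃ s ∈ S, Nonempty (Pth H s x)}

/-- The vertices from which a vertex in `S` can be reached. -/
def Preds (S : Set V) : Set V := {x | ∃ s ∈ S, Nonempty (Pth H x s)}

variable {H}

theorem subset_succs (S : Set V) : S ⊆ Succs H S := fun s hs => ⟨s, hs, ⟨.nil⟩⟩

theorem subset_preds (S : Set V) : S ⊆ Preds H S := fun s hs => ⟨s, hs, ⟨.nil⟩⟩

theorem succs_mono {S T : Set V} (h : S ⊆ T) : Succs H S ⊆ Succs H T :=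
  fun _ ⟨s, hs, p⟩ => ⟨s, h hs, p⟩

theorem preds_mono {S T : Set V} (h : S ⊆ T) : Preds H S ⊆ Preds H T :=
  fun _ ⟨s, hs, p⟩ => ⟨s, h hs, p⟩

theorem succs_arrow {S : Set V} {x y : V} (α : H x y) (hx : x ∈ Succs H S) : y ∈ Succs H S := by
  obtain ⟨s, hs, ⟨p⟩⟩ := hx
  exact ⟨s, hs, ⟨p.cons α⟩⟩

theorem preds_arrow {S : Set V} {x y : V} (α : H x y) (hy : y ∈ Preds H S) : x ∈ Preds H S := by
  obtain ⟨s, hs, ⟨p⟩⟩ := hy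
  exact ⟨s, hs, ⟨p.pre α⟩⟩

theorem succs_opp (S : Set V) : Succs (Opp H) S = Preds H S := by
  ext x
  exact ⟨fun ⟨s, hs, ⟨p⟩⟩ => ⟨s, hs, ⟨Pth.rev (H := Opp H) p⟩⟩,
    fun ⟨s, hs, ⟨p⟩⟩ => ⟨s, hs, ⟨p.rev⟩⟩⟩

theorem finite_succs_inter_preds [SLF H] {S T : Set V} (hS : S.Finite) (hT : T.Finite) :
    (Succs H S ∩ Preds H T).Finite := by
  have : (⋃ s ∈ S, ⋃ t ∈ T, ⋃ r : Pth H s t, r.verts).Finite :=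
    hS.biUnion fun s _ => hT.biUnion fun t _ => Set.finite_iUnion fun r => r.finite_verts
  refine this.subset ?_
  rintro x ⟨⟨s, hs, ⟨p⟩⟩, t, ht, ⟨q⟩⟩
  simp only [Set.mem_iUnion]
  exact ⟨s, hs, t, ht, p.append q, p.mem_verts_append q⟩

theorem eq_nil_of_loop [SLF H] {x : V} (p : Pth H x x) : p = .nil := by
  by_contra hp
  have hl : 0 < p.length := by
    cases p with
    | nil => exact absurd rfl hp
    | cons p α => exact Nat.succ_pos _
  let c : ℕ → Pth H x x := fun n => Nat.rec .nil (fun _ q => q.append p) n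
  have hc : ∀ n, (c n).length = n * p.length := by
    intro n
    induction n with
    | zero => simp [c, Pth.length]
    | succ n ih =>
      change ((c n).append p).length = _
      rw [Pth.length_append, ih, Nat.succ_mul]
  have hinj : Function.Injective c := by
    intro m n h
    have := congrArg Pth.length h
    rw [hc, hc] at this
    exact Nat.eq_of_mul_eq_mul_right hl this
  exact not_injective_infinite_finite c hinj

theorem eq_of_paths [SLF H] {x y : V} (p : Pth H x y) (q : Pth H y x) : x = y := by
  cases q with
  | nil => rfl
  | cons q α => exact absurd (eq_nil_of_loop ((p.append q).cons α)) (by simp)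

theorem isEmpty_path_of_arrow [SLF H] {x y : V} (α : H y x) : IsEmpty (Pth H x y) :=
  ⟨fun p => absurd (eq_nil_of_loop (p.cons α)) (by simp)⟩

/-- Arrows that start at a vertex reachable from `S`. -/
def SRel (H : V → V → Type) (S : Set V) (x y : V) : Prop := Nonempty (H x y) ∧ x ∈ Succs H S

theorem wellFounded_sRel [SLF H] {S : Set V} (hS : S.Finite) : WellFounded (SRel H S) := by
  let L : V → Set ℕ := fun y => ⋃ s ∈ S, Set.range fun p : Pth H s y => p.length
  have hL : ∀ y, (L y).Finite := fun y => hS.biUnion fun s _ => Set.finite_range _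
  refine Subrelation.wf (r := InvImage (· < ·) fun y => sSup (L y)) ?_ (InvImage.wf _ wellFounded_lt)
  rintro x y ⟨⟨α⟩, s, hs, ⟨p⟩⟩
  have hne : (L x).Nonempty := ⟨p.length, by simp only [L, Set.mem_iUnion]; exact ⟨s, hs, p, rfl⟩⟩
  have hmem := Nat.sSup_mem hne (hL x).bddAbove
  change sSup (L x) < sSup (L y)
  obtain ⟨t, ht, q, hq⟩ : ∃ t, ∃ _ : t ∈ S, ∃ q : Pth H t x, q.length = sSup (L x) := by
    simpa only [L, Set.mem_iUnion, Set.mem_range] using hmem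
  refine Nat.lt_of_succ_le (le_csSup (hL y).bddAbove ?_)
  simp only [L, Set.mem_iUnion]
  exact ⟨t, ht, q.cons α, by simp [Pth.length, hq, L]⟩

end Paths

section Representations

/-- A locally finite dimensional representation of the quiver with arrows `H`. -/
structure QRep (k : Type) [Field k] {V : Type} (H : V → V → Type) where
  X : V → Type
  [grp : ∀ x, AddCommGroup (X x)]
  [mod : ∀ x, Module k (X x)]
  [fin : ∀ x, FiniteDimensional k (X x)]
  map : ∀ {x y : V}, H x y → X x →ₗ[k] X y

attribute [instance] QRep.grp QRep.mod QRep.fin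

namespace QRep

variable {k : Type} [Field k] {V : Type} {H : V → V → Type}

/-- A family of linear maps between the values of two representations. -/
abbrev Fam (M N : QRep k H) := ∀ x, M.X x →ₗ[k] N.X x

/-- A family of linear maps is a morphism of representations. -/
def IsHom {M N : QRep k H} (φ : Fam M N) : Prop :=
  ∀ ⦃x y : V⦄ (α : H x y) (m : M.X x), φ y (M.map α m) = N.map α (φ x m)

/-- The identity family. -/
abbrev idf (M : QRep k H) : Fam M M := fun _ => LinearMap.id

/-- Composition of families. -/
abbrev cmp {L M N : QRep k H} (ψ : Fam M N) (φ : Fam L M) : Fam L N := fun x => ψ x ∘ₗ φ x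

theorem isHom_id (M : QRep k H) : IsHom (idf M) := fun _ _ _ _ => rfl

theorem IsHom.cmp {L M N : QRep k H} {ψ : Fam M N} {φ : Fam L M} (hψ : IsHom ψ) (hφ : IsHom φ) :
    IsHom (cmp ψ φ) := fun x y α m => by simp [hφ α, hψ α]

theorem IsHom.sub {M N : QRep k H} {φ ψ : Fam M N} (hφ : IsHom φ) (hψ : IsHom ψ) :
    IsHom (fun x => φ x - ψ x) := fun x y α m => by simp [hφ α, hψ α]

theorem IsHom.add {M N : QRep k H} {φ ψ : Fam M N} (hφ : IsHom φ) (hψ : IsHom ψ) :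
    IsHom (fun x => φ x + ψ x) := fun x y α m => by simp [hφ α, hψ α]

/-- A family is a split monomorphism. -/
def SplitMono {M N : QRep k H} (φ : Fam M N) : Prop :=
  ∃ r : Fam N M, IsHom r ∧ ∀ x m, r x (φ x m) = m

/-- A family is a split epimorphism. -/
def SplitEpi {M N : QRep k H} (φ : Fam M N) : Prop :=
  ∃ s : Fam N M, IsHom s ∧ ∀ x n, φ x (s x n) = n

/-- A family is an irreducible morphism of representations. -/
structure Irr {M N : QRep k H} (f : Fam M N) : Prop where
  hom : IsHom f
  not_mono : ¬ SplitMono f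
  not_epi : ¬ SplitEpi f
  factor : ∀ (X : QRep k H) (g : Fam M X) (h : Fam X N), IsHom g → IsHom h →
    (∀ x m, h x (g x m) = f x m) → SplitMono g ∨ SplitEpi h

/-- Every endomorphism of `M` is injective, or its difference with the identity is. -/
def Loc (M : QRep k H) : Prop :=
  ∀ θ : Fam M M, IsHom θ → (∀ x m, θ x m = 0 → m = 0) ∨ ∀ x m, θ x m = m → m = 0

theorem exists_inverse {M N : QRep k H} {φ : Fam M N} (hφ : IsHom φ)
    (hb : ∀ x, Function.Bijective (φ x)) :
    ∃ ψ : Fam N M, IsHom ψ ∧ (∀ x m, ψ x (φ x m) = m) ∧ ∀ x n, φ x (ψ x n) = n := by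
  let e := fun x => LinearEquiv.ofBijective (φ x) (hb x)
  have h1 : ∀ x n, φ x ((e x).symm n) = n := fun x n => (e x).apply_symm_apply n
  refine ⟨fun x => (e x).symm.toLinearMap, ?_, fun x m => (e x).symm_apply_apply m, h1⟩
  intro x y α n
  apply (hb y).1
  change φ y ((e y).symm (N.map α n)) = φ y (M.map α ((e x).symm n))
  rw [h1, hφ α, h1]

theorem bijective_of_injective {M : QRep k H} (θ : Fam M M)
    (h : ∀ x m, θ x m = 0 → m = 0) (x : V) : Function.Bijective (θ x) := by
  have hi : Function.Injective (θ x) := (injective_iff_map_eq_zero _).2 (h x)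
  exact ⟨hi, LinearMap.surjective_of_injective hi⟩

/-- A family of submodules is a subrepresentation. -/
def Stable (M : QRep k H) (U : ∀ x, Submodule k (M.X x)) : Prop :=
  ∀ ⦃x y : V⦄ (α : H x y) (m : M.X x), m ∈ U x → M.map α m ∈ U y

/-- The representation given by a stable family of submodules. -/
abbrev sub (M : QRep k H) (U : ∀ x, Submodule k (M.X x)) (hU : M.Stable U) : QRep k H where
  X x := U x
  map α := (M.map α).restrict (hU α)

/-- The inclusion of a subrepresentation. -/
abbrev subι (M : QRep k H) (U : ∀ x, Submodule k (M.X x)) (hU : M.Stable U) : Fam (M.sub U hU) M :=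
  fun x => (U x).subtype

theorem isHom_subι (M : QRep k H) (U : ∀ x, Submodule k (M.X x)) (hU : M.Stable U) :
    IsHom (M.subι U hU) := fun _ _ _ _ => rfl

/-- The quotient by a stable family of submodules. -/
abbrev quo (M : QRep k H) (U : ∀ x, Submodule k (M.X x)) (hU : M.Stable U) : QRep k H where
  X x := M.X x ⧸ U x
  map {x y} α := (U x).mapQ (U y) (M.map α) (hU α)

/-- The projection to a quotient. -/
abbrev quoπ (M : QRep k H) (U : ∀ x, Submodule k (M.X x)) (hU : M.Stable U) : Fam M (M.quo U hU) :=
  fun x => (U x).mkQ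

theorem isHom_quoπ (M : QRep k H) (U : ∀ x, Submodule k (M.X x)) (hU : M.Stable U) :
    IsHom (M.quoπ U hU) := fun _ _ _ _ => rfl

/-- The kernel of a morphism, as a family of submodules. -/
abbrev kerF {M N : QRep k H} (φ : Fam M N) : ∀ x, Submodule k (M.X x) := fun x => LinearMap.ker (φ x)

/-- The image of a morphism, as a family of submodules. -/
abbrev ranF {M N : QRep k H} (φ : Fam M N) : ∀ x, Submodule k (N.X x) :=
  fun x => LinearMap.range (φ x)

theorem IsHom.stable_ker {M N : QRep k H} {φ : Fam M N} (hφ : IsHom φ) : M.Stable (kerF φ) := by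
  intro x y α m hm
  rw [LinearMap.mem_ker] at hm ⊢
  rw [hφ α, hm, map_zero]

theorem IsHom.stable_ran {M N : QRep k H} {φ : Fam M N} (hφ : IsHom φ) : N.Stable (ranF φ) := by
  rintro x y α _ ⟨m, rfl⟩
  exact ⟨M.map α m, hφ α m⟩

/-- The product of two representations. -/
abbrev prd (M N : QRep k H) : QRep k H where
  X x := M.X x × N.X x
  map α := (M.map α).prodMap (N.map α)

/-- A family into a product. -/
abbrev pair {L M N : QRep k H} (φ : Fam L M) (ψ : Fam L N) : Fam L (M.prd N) :=
  fun x => (φ x).prod (ψ x)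

/-- The first projection. -/
abbrev fstF (M N : QRep k H) : Fam (M.prd N) M := fun _ => LinearMap.fst k _ _

/-- The second projection. -/
abbrev sndF (M N : QRep k H) : Fam (M.prd N) N := fun _ => LinearMap.snd k _ _

theorem IsHom.pair {L M N : QRep k H} {φ : Fam L M} {ψ : Fam L N} (hφ : IsHom φ) (hψ : IsHom ψ) :
    IsHom (pair φ ψ) := fun _ _ α m => Prod.ext (hφ α m) (hψ α m)

theorem isHom_fst (M N : QRep k H) : IsHom (fstF M N) := fun _ _ _ _ => rfl

theorem isHom_snd (M N : QRep k H) : IsHom (sndF M N) := fun _ _ _ _ => rfl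

/-- The product of a family of representations indexed by a finite type. -/
abbrev piRep {ι : Type} [Finite ι] (M : ι → QRep k H) : QRep k H where
  X x := ∀ i, (M i).X x
  map α := LinearMap.pi fun i => ((M i).map α) ∘ₗ LinearMap.proj i

/-- The dual of a representation, a representation of the opposite quiver. -/
abbrev dual (M : QRep k H) : QRep k (Opp H) where
  X x := Module.Dual k (M.X x)
  map {x y} α := (M.map (show H y x from α)).dualMap

/-- The dual of a family. -/
abbrev dualF {M N : QRep k H} (φ : Fam M N) : Fam N.dual M.dual := fun x => (φ x).dualMap

theorem IsHom.dual {M N : QRep k H} {φ : Fam M N} (hφ : IsHom φ) : IsHom (dualF φ) := by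
  intro x y α ξ
  apply LinearMap.ext
  intro m
  exact congrArg (fun n => ξ n) (hφ α m).symm

/-- A short exact sequence of representations. -/
structure SES {A B C : QRep k H} (i : Fam A B) (p : Fam B C) : Prop where
  hom_i : IsHom i
  hom_p : IsHom p
  inj : ∀ x, Function.Injective (i x)
  surj : ∀ x, Function.Surjective (p x)
  zero : ∀ x a, p x (i x a) = 0
  exact : ∀ x b, p x b = 0 → ∃ a, i x a = b

theorem ses_coker {M N : QRep k H} {f : Fam M N} (hf : IsHom f)
    (hi : ∀ x, Function.Injective (f x)) : SES f (N.quoπ (ranF f) hf.stable_ran) where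
  hom_i := hf
  hom_p := isHom_quoπ _ _ _
  inj := hi
  surj _ := Submodule.mkQ_surjective _
  zero _ a := (Submodule.Quotient.mk_eq_zero _).2 ⟨a, rfl⟩
  exact _ _ hb := (Submodule.Quotient.mk_eq_zero _).1 hb

theorem ses_ker {M N : QRep k H} {f : Fam M N} (hf : IsHom f)
    (hs : ∀ x, Function.Surjective (f x)) : SES (M.subι (kerF f) hf.stable_ker) f where
  hom_i := isHom_subι _ _ _
  hom_p := hf
  inj _ := Subtype.val_injective
  surj := hs
  zero _ a := a.2
  exact _ b hb := ⟨⟨b, hb⟩, rfl⟩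

theorem SES.dual {A B C : QRep k H} {i : Fam A B} {p : Fam B C} (h : SES i p) :
    SES (dualF p) (dualF i) where
  hom_i := h.hom_p.dual
  hom_p := h.hom_i.dual
  inj x := LinearMap.dualMap_injective_of_surjective (h.surj x)
  surj x := LinearMap.dualMap_surjective_of_injective (h.inj x)
  zero x ξ := by
    apply LinearMap.ext
    intro a
    exact (congrArg (fun c => ξ c) (h.zero x a)).trans (map_zero ξ)
  exact x ξ hξ := by
    have hr : LinearMap.range (p x).dualMap = (LinearMap.ker (p x)).dualAnnihilator :=
      LinearMap.range_dualMap_eq_dualAnnihilator_ker _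
    have : ξ ∈ LinearMap.range (p x).dualMap := by
      rw [hr, Submodule.mem_dualAnnihilator]
      intro b hb
      obtain ⟨a, rfl⟩ := h.exact x b hb
      exact LinearMap.congr_fun hξ a
    exact this

variable [SLF H]

/-- The sum of the maps attached to the arrows ending at `x`. -/
noncomputable def inc (M : QRep k H) (x : V) : (∀ a : Σ y, H y x, M.X a.1) →ₗ[k] M.X x :=
  ∑ a : Σ y, H y x, M.map a.2 ∘ₗ LinearMap.proj a

theorem inc_apply (M : QRep k H) (x : V) (w : ∀ a : Σ y, H y x, M.X a.1) :
    M.inc x w = ∑ a : Σ y, H y x, M.map a.2 (w a) := by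
  simp [inc]

open Classical in
theorem inc_single (M : QRep k H) {x y : V} (α : H y x) (m : M.X y) :
    M.inc x (Pi.single (M := fun a : Σ y, H y x => M.X a.1) ⟨y, α⟩ m) = M.map α m := by
  rw [inc_apply, Finset.sum_eq_single ⟨y, α⟩]
  · simp
  · intro b _ hb
    rw [Pi.single_eq_of_ne hb, map_zero]
  · simp

theorem IsHom.inc {M N : QRep k H} {φ : Fam M N} (hφ : IsHom φ) (x : V)
    (w : ∀ a : Σ y, H y x, M.X a.1) : φ x (M.inc x w) = N.inc x fun a => φ a.1 (w a) := by
  simp only [inc_apply, map_sum, hφ _ _]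

/-- Finite presentation, expressed by the maps attached to the arrows ending at a vertex. -/
def FPres (M : QRep k H) : Prop :=
  ∃ S : Set V, S.Finite ∧ (∀ x, x ∉ Succs H S → ∀ m : M.X x, m = 0) ∧
    ∀ x, x ∉ S → Function.Bijective (M.inc x)

theorem SES.fpres_mid {A B C : QRep k H} {i : Fam A B} {p : Fam B C} (h : SES i p)
    (hA : A.FPres) (hC : C.FPres) : B.FPres := by
  obtain ⟨S, hS, hSs, hSb⟩ := hA
  obtain ⟨T, hT, hTs, hTb⟩ := hC
  refine ⟨S ∪ T, hS.union hT, fun x hx b => ?_, fun x hx => ⟨?_, fun b => ?_⟩⟩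
  · obtain ⟨a, rfl⟩ := h.exact x b (hTs x (fun h' => hx (succs_mono Set.subset_union_right h')) _)
    rw [hSs x (fun h' => hx (succs_mono Set.subset_union_left h')) a, map_zero]
  · rw [injective_iff_map_eq_zero]
    intro w hw
    have h1 : C.inc x (fun a => p a.1 (w a)) = 0 := by rw [← h.hom_p.inc, hw, map_zero]
    have h2 := (injective_iff_map_eq_zero _).1 (hTb x fun h' => hx (.inr h')).1 _ h1
    choose v hv using fun a => h.exact a.1 (w a) (congrFun h2 a)
    obtain rfl : (fun a => i a.1 (v a)) = w := funext hv
    have h3 : A.inc x v = 0 := h.inj x (by rw [h.hom_i.inc, hw, map_zero])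
    have h4 := (injective_iff_map_eq_zero _).1 (hSb x fun h' => hx (.inl h')).1 _ h3
    subst h4
    funext a
    simp
  · obtain ⟨u, hu⟩ := (hTb x fun h' => hx (.inr h')).2 (p x b)
    choose w hw using fun a : Σ y, H y x => h.surj a.1 (u a)
    obtain ⟨a, ha⟩ := h.exact x (b - B.inc x w) (by
      rw [map_sub, h.hom_p.inc, funext hw, hu, sub_self])
    obtain ⟨v, rfl⟩ := (hSb x fun h' => hx (.inl h')).2 a
    refine ⟨w + fun a => i a.1 (v a), ?_⟩
    rw [map_add, ← h.hom_i.inc, ha]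
    abel

theorem SES.fpres_left {A B C : QRep k H} {i : Fam A B} {p : Fam B C} (h : SES i p)
    (hB : B.FPres) (hC : C.FPres) : A.FPres := by
  obtain ⟨S, hS, hSs, hSb⟩ := hB
  obtain ⟨T, hT, -, hTb⟩ := hC
  refine ⟨S ∪ T, hS.union hT, fun x hx a => ?_, fun x hx => ⟨?_, fun a => ?_⟩⟩
  · apply h.inj x
    rw [hSs x (fun h' => hx (succs_mono Set.subset_union_left h')) (i x a), map_zero]
  · rw [injective_iff_map_eq_zero]
    intro v hv
    have h1 : B.inc x (fun a => i a.1 (v a)) = 0 := by rw [← h.hom_i.inc, hv, map_zero]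
    have h2 := (injective_iff_map_eq_zero _).1 (hSb x fun h' => hx (.inl h')).1 _ h1
    funext a
    exact h.inj a.1 ((congrFun h2 a).trans (map_zero _).symm)
  · obtain ⟨w, hw⟩ := (hSb x fun h' => hx (.inl h')).2 (i x a)
    have h1 : C.inc x (fun a => p a.1 (w a)) = 0 := by rw [← h.hom_p.inc, hw, h.zero]
    have h2 := (injective_iff_map_eq_zero _).1 (hTb x fun h' => hx (.inr h')).1 _ h1
    choose v hv using fun a => h.exact a.1 (w a) (congrFun h2 a)
    refine ⟨v, h.inj x ?_⟩
    rw [h.hom_i.inc, funext hv, hw]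

theorem FPres.of_bijective {M N : QRep k H} (hM : M.FPres) {φ : Fam M N} (hφ : IsHom φ)
    (hb : ∀ x, Function.Bijective (φ x)) : N.FPres := by
  obtain ⟨S, hS, hSs, hSb⟩ := hM
  refine ⟨S, hS, fun x hx n => ?_, fun x hx => ⟨?_, fun n => ?_⟩⟩
  · obtain ⟨m, rfl⟩ := (hb x).2 n
    rw [hSs x hx m, map_zero]
  · rw [injective_iff_map_eq_zero]
    intro w hw
    choose v hv using fun a : Σ y, H y x => (hb a.1).2 (w a)
    obtain rfl : (fun a => φ a.1 (v a)) = w := funext hv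
    have h1 : M.inc x v = 0 := (hb x).1 (by rw [hφ.inc, hw, map_zero])
    have h2 := (injective_iff_map_eq_zero _).1 (hSb x hx).1 _ h1
    subst h2
    funext a
    simp
  · obtain ⟨m, rfl⟩ := (hb x).2 n
    obtain ⟨v, rfl⟩ := (hSb x hx).2 m
    exact ⟨_, (hφ.inc x v).symm⟩

/-- The support of a representation. -/
def supp (M : QRep k H) : Set V := {x | ∃ m : M.X x, m ≠ 0}

omit [SLF H] in
theorem eq_zero_of_notMem_supp {M : QRep k H} {x : V} (hx : x ∉ M.supp) (m : M.X x) : m = 0 := by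
  by_contra hm
  exact hx ⟨m, hm⟩

theorem fpres_of_finite_supp (M : QRep k H) (h : M.supp.Finite) : M.FPres := by
  have hfin : (⋃ x ∈ M.supp, Set.range fun a : Σ y, H x y => a.1).Finite :=
    h.biUnion fun x _ => by
      have := SLF.out (H := H) x
      exact Set.finite_range _
  refine ⟨M.supp ∪ ⋃ x ∈ M.supp, Set.range fun a : Σ y, H x y => a.1, h.union hfin, ?_, ?_⟩
  · intro x hx
    exact eq_zero_of_notMem_supp fun h' => hx (subset_succs _ (.inl h'))
  · intro x hx
    constructor
    · rw [injective_iff_map_eq_zero]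
      intro w _
      funext a
      refine eq_zero_of_notMem_supp (fun h' => hx (.inr ?_)) _
      simp only [Set.mem_iUnion]
      exact ⟨a.1, h', ⟨x, a.2⟩, rfl⟩
    · intro m
      exact ⟨0, by rw [map_zero, eq_zero_of_notMem_supp (fun h' => hx (.inl h')) m]⟩

theorem fpres_pi {ι : Type} [Finite ι] (M : ι → QRep k H) (h : ∀ i, (M i).FPres) :
    (piRep M).FPres := by
  choose S hS hSs hSb using h
  have key : ∀ x (w : ∀ a : Σ y, H y x, (piRep M).X a.1) i,
      (piRep M).inc x w i = (M i).inc x fun a => w a i := by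
    intro x w i
    have hp : IsHom (M := piRep M) (N := M i) fun x => LinearMap.proj i := fun _ _ _ _ => rfl
    exact hp.inc x w
  refine ⟨⋃ i, S i, Set.finite_iUnion hS, fun x hx m => ?_, fun x hx => ⟨?_, fun m => ?_⟩⟩
  · funext i
    exact hSs i x (fun h' => hx (succs_mono (Set.subset_iUnion S i) h')) (m i)
  · rw [injective_iff_map_eq_zero]
    intro w hw
    funext a i
    have h1 : (M i).inc x (fun a => w a i) = 0 := by
      rw [← key, hw]; rfl
    exact congrFun ((injective_iff_map_eq_zero _).1
      (hSb i x fun h' => hx (Set.mem_iUnion.2 ⟨i, h'⟩)).1 _ h1) a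
  · choose w hw using fun i => (hSb i x fun h' => hx (Set.mem_iUnion.2 ⟨i, h'⟩)).2 (m i)
    refine ⟨fun a i => w i a, ?_⟩
    funext i
    exact (key _ _ _).trans (hw i)

/-- `M` is generated by its values at the vertices in `S`. -/
def GenBy (M : QRep k H) (S : Set V) : Prop :=
  ∀ U, M.Stable U → (∀ s ∈ S, U s = ⊤) → ∀ x, U x = ⊤

omit [SLF H] in
theorem GenBy.eq_zero {M : QRep k H} {S : Set V} (h : M.GenBy S) {x : V} (hx : x ∉ Succs H S)
    (m : M.X x) : m = 0 := by
  classical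
  have := h (fun y => if y ∈ Succs H S then ⊤ else ⊥) (fun y z α m hm => by
    by_cases hy : y ∈ Succs H S
    · simp [succs_arrow α hy]
    · simp only [if_neg hy, Submodule.mem_bot] at hm
      rw [hm, map_zero]
      exact Submodule.zero_mem _) (fun s hs => if_pos (subset_succs S hs)) x
  rw [if_neg hx] at this
  have hm : m ∈ (⊥ : Submodule k (M.X x)) := this ▸ Submodule.mem_top
  exact hm

theorem map_mem_range_inc (M : QRep k H) {x y : V} (α : H y x) (m : M.X y) :
    M.map α m ∈ LinearMap.range (M.inc x) :=
  ⟨_, M.inc_single α m⟩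

theorem GenBy.inc_surjective {M : QRep k H} {S : Set V} (h : M.GenBy S) {x : V} (hx : x ∉ S) :
    Function.Surjective (M.inc x) := by
  classical
  have := h (fun y => LinearMap.range (M.inc y) ⊔ if y ∈ S then ⊤ else ⊥) (fun y z α m _ =>
    Submodule.mem_sup_left (M.map_mem_range_inc α m)) (fun s hs => by simp [hs]) x
  simp only [if_neg hx, sup_bot_eq] at this
  exact LinearMap.range_eq_top.1 this

theorem genBy_of_surjective {M : QRep k H} {S : Set V} (hS : S.Finite)
    (h0 : ∀ x, x ∉ Succs H S → ∀ m : M.X x, m = 0)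
    (h1 : ∀ x, x ∉ S → Function.Surjective (M.inc x)) : M.GenBy S := by
  intro U hU hUS x
  refine (wellFounded_sRel (H := H) hS).induction (C := fun x => U x = ⊤) x fun x ih => ?_
  by_cases hx : x ∈ S
  · exact hUS x hx
  · rw [eq_top_iff]
    intro m _
    obtain ⟨w, rfl⟩ := h1 x hx m
    rw [inc_apply]
    refine Submodule.sum_mem _ fun a _ => hU a.2 _ ?_
    by_cases ha : a.1 ∈ Succs H S
    · rw [ih a.1 ⟨⟨a.2⟩, ha⟩]
      exact Submodule.mem_top
    · rw [h0 _ ha (w a)]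
      exact Submodule.zero_mem _

end QRep

end Representations

section LinearSystems

variable {k : Type} [Field k] {ι J : Type} {W : ι → Type} [∀ i, AddCommGroup (W i)]
  [∀ i, Module k (W i)] [∀ i, FiniteDimensional k (W i)] {E : J → Type}
  [∀ j, AddCommGroup (E j)] [∀ j, Module k (E j)]

/-- A linear map on a product depends on finitely many coordinates only. -/
def DependsFin {W : ι → Type} [∀ i, AddCommGroup (W i)] [∀ i, Module k (W i)] {E : Type}
    [AddCommGroup E] [Module k E] (L : (∀ i, W i) →ₗ[k] E) : Prop :=
  ∃ s : Finset ι, ∀ w : ∀ i, W i, (∀ i ∈ s, w i = 0) → L w = 0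

theorem exists_solution_of_functionals (ℓ : J → Module.Dual k (∀ i, W i)) (b : J → k)
    (hl : ∀ j, DependsFin (ℓ j)) (h : ∀ F : Finset J, ∃ w, ∀ j ∈ F, ℓ j w = b j) :
    ∃ w, ∀ j, ℓ j w = b j := by
  classical
  let T : (J →₀ k) →ₗ[k] Module.Dual k (∀ i, W i) := Finsupp.linearCombination k ℓ
  let c : (J →₀ k) →ₗ[k] k := Finsupp.linearCombination k b
  have hc : c ∈ LinearMap.range T.dualMap := by
    rw [LinearMap.range_dualMap_eq_dualAnnihilator_ker, Submodule.mem_dualAnnihilator]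
    intro a ha
    obtain ⟨w, hw⟩ := h a.support
    have h1 : T a w = 0 := by rw [LinearMap.mem_ker.1 ha]; rfl
    rw [← h1]
    simp only [T, c, Finsupp.linearCombination_apply, Finsupp.sum, LinearMap.sum_apply,
      LinearMap.smul_apply]
    exact Finset.sum_congr rfl fun j hj => by rw [hw j hj]
  obtain ⟨g, hg⟩ := hc
  let w : ∀ i, W i := fun i =>
    (Module.evalEquiv k (W i)).symm (g ∘ₗ (LinearMap.proj (φ := W) i).dualMap)
  have hw : ∀ i (ξ : Module.Dual k (W i)), ξ (w i) = g (ξ ∘ₗ LinearMap.proj i) := by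
    intro i ξ
    exact Module.apply_evalEquiv_symm_apply k (W i) ξ _
  refine ⟨w, fun j => ?_⟩
  obtain ⟨s, hs⟩ := hl j
  have hdec : ∀ v : ∀ i, W i, ℓ j v = ∑ i ∈ s, ℓ j (LinearMap.single k W i (v i)) := by
    intro v
    rw [← map_sum, ← sub_eq_zero, ← map_sub]
    apply hs
    intro i hi
    rw [Pi.sub_apply, Finset.sum_apply, Finset.sum_eq_single i]
    · simp
    · intro i' _ hne
      simp [Pi.single_eq_of_ne hne.symm]
    · exact fun h' => absurd hi h'
  have h2 : ℓ j = ∑ i ∈ s, (ℓ j ∘ₗ LinearMap.single k W i) ∘ₗ LinearMap.proj i := by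
    apply LinearMap.ext
    intro v
    rw [hdec v]
    simp
  have h3 : g (ℓ j) = b j := by
    have := LinearMap.congr_fun hg (Finsupp.single j 1)
    simpa [T, c] using this
  rw [hdec w, ← h3, (congrArg g h2).trans (map_sum g _ s)]
  exact Finset.sum_congr rfl fun i _ => hw i (ℓ j ∘ₗ LinearMap.single k W i)

theorem exists_solution (L : ∀ j, (∀ i, W i) →ₗ[k] E j) (b : ∀ j, E j)
    (hl : ∀ j, DependsFin (L j)) (h : ∀ F : Finset J, ∃ w, ∀ j ∈ F, L j w = b j) :
    ∃ w, ∀ j, L j w = b j := by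
  classical
  obtain ⟨w, hw⟩ := exists_solution_of_functionals (J := Σ j, Module.Dual k (E j))
    (fun j => j.2 ∘ₗ L j.1) (fun j => j.2 (b j.1))
    (fun j => (hl j.1).imp fun s hs w hw => by
      rw [LinearMap.comp_apply, hs w hw, map_zero]) (fun F => by
      obtain ⟨w, hw⟩ := h (F.image Sigma.fst)
      exact ⟨w, fun j hj => by
        rw [LinearMap.comp_apply, hw j.1 (Finset.mem_image_of_mem _ hj)]⟩)
  refine ⟨w, fun j => ?_⟩
  rw [← sub_eq_zero, ← Module.forall_dual_apply_eq_zero_iff k]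
  intro ξ
  rw [map_sub, sub_eq_zero]
  exact hw ⟨j, ξ⟩

theorem exists_solution_mem (U : ∀ i, Submodule k (W i)) (L : ∀ j, (∀ i, W i) →ₗ[k] E j)
    (b : ∀ j, E j) (hl : ∀ j, DependsFin (L j))
    (h : ∀ F : Finset J, ∃ w, (∀ i, w i ∈ U i) ∧ ∀ j ∈ F, L j w = b j) :
    ∃ w, (∀ i, w i ∈ U i) ∧ ∀ j, L j w = b j := by
  let ι' : (∀ i, U i) →ₗ[k] ∀ i, W i := LinearMap.pi fun i => (U i).subtype ∘ₗ LinearMap.proj i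
  obtain ⟨w, hw⟩ := exists_solution (W := fun i => U i) (fun j => L j ∘ₗ ι') b
    (fun j => (hl j).imp fun s hs w hw => hs _ fun i hi => by simp [ι', hw i hi])
    (fun F => by
      obtain ⟨w, hwU, hw⟩ := h F
      exact ⟨fun i => ⟨w i, hwU i⟩, hw⟩)
  exact ⟨fun i => w i, fun i => (w i).2, hw⟩

theorem exists_stable_finset (L : ∀ j, (∀ i, W i) →ₗ[k] E j) (hl : ∀ j, DependsFin (L j))
    (S : Finset ι) : ∃ F : Finset J, ∀ w, (∀ j ∈ F, L j w = 0) →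
      ∃ w', (∀ j, L j w' = 0) ∧ ∀ i ∈ S, w' i = w i := by
  classical
  let sol : Finset J → Submodule k (∀ i, W i) := fun F => ⨅ j ∈ F, LinearMap.ker (L j)
  have hsol : ∀ F w, w ∈ sol F ↔ ∀ j ∈ F, L j w = 0 := by
    intro F w
    simp [sol, Submodule.mem_iInf]
  let res : (∀ i, W i) →ₗ[k] ∀ i : S, W i := LinearMap.pi fun i => LinearMap.proj i.1
  let P : Finset J → Submodule k (∀ i : S, W i) := fun F => (sol F).map res
  obtain ⟨_, ⟨F, rfl⟩, hF⟩ := WellFounded.has_min (wellFounded_lt (α := Submodule k (∀ i : S, W i)))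
    (Set.range P) ⟨_, ⟨∅, rfl⟩⟩
  refine ⟨F, fun w hw => ?_⟩
  have hmem : ∀ F' : Finset J, ∃ v, (∀ j ∈ F', L j v = 0) ∧ ∀ i ∈ S, v i = w i := by
    intro F'
    have hle : P (F ∪ F') ≤ P F := Submodule.map_mono fun v hv =>
      (hsol _ _).2 fun j hj => (hsol _ _).1 hv j (Finset.mem_union_left _ hj)
    have heq : P (F ∪ F') = P F := by
      by_contra hne
      exact hF _ ⟨_, rfl⟩ (lt_of_le_of_ne hle hne)
    have hw' : res w ∈ P F := ⟨w, (hsol _ _).2 hw, rfl⟩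
    rw [← heq] at hw'
    obtain ⟨v, hv, hvw⟩ := hw'
    exact ⟨v, fun j hj => (hsol _ _).1 hv j (Finset.mem_union_right _ hj),
      fun i hi => congrFun hvw ⟨i, hi⟩⟩
  obtain ⟨u, huU, hu⟩ := exists_solution_mem (fun i => if i ∈ S then ⊥ else ⊤) L
    (fun j => - L j w) hl fun F' => by
      obtain ⟨v, hv, hvw⟩ := hmem F'
      refine ⟨v - w, fun i => ?_, fun j hj => ?_⟩
      · by_cases hi : i ∈ S
        · simp [hi, hvw i hi]
        · simp [hi]
      · rw [map_sub, hv j hj, zero_sub]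
  refine ⟨u + w, fun j => by rw [map_add, hu, neg_add_cancel], fun i hi => ?_⟩
  have := huU i
  rw [if_pos hi, Submodule.mem_bot] at this
  rw [Pi.add_apply, this, zero_add]

end LinearSystems

section Extensions

namespace QRep

variable {k : Type} [Field k] {V : Type} {H : V → V → Type}

/-- The data of an extension of `C` by `M` with split values. -/
abbrev Cocycle (M C : QRep k H) := ∀ ⦃x y : V⦄, H x y → C.X x →ₗ[k] M.X y

/-- The extension of `C` by `M` attached to a cocycle. -/
abbrev extRep {M C : QRep k H} (e : Cocycle M C) : QRep k H where
  X x := M.X x × C.X x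
  map α := ((M.map α).coprod (e α)).prod (C.map α ∘ₗ LinearMap.snd k _ _)

/-- The coboundary of a family. -/
def cobd {M C : QRep k H} (h : Fam C M) : Cocycle M C :=
  fun x y α => M.map α ∘ₗ h x - h y ∘ₗ C.map α

theorem cobd_apply {M C : QRep k H} (h : Fam C M) {x y : V} (α : H x y) (c : C.X x) :
    cobd h α c = M.map α (h x c) - h y (C.map α c) := rfl

/-- The extension given by `e` is, up to isomorphism, the pushout of the one given by `e'`. -/
def Red {C Z M : QRep k H} (e' : Cocycle Z C) (e : Cocycle M C) : Prop :=
  ∃ θ : Fam Z M, IsHom θ ∧ ∃ h : Fam C M, ∀ ⦃x y : V⦄ (α : H x y) (c : C.X x),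
    θ y (e' α c) = e α c + cobd h α c

/-- The properties of an extension whose inclusion is an irreducible morphism. -/
structure Crit {M C : QRep k H} (e : Cocycle M C) : Prop where
  nonsplit : ¬ ∃ h : Fam C M, ∀ ⦃x y : V⦄ (α : H x y) (c : C.X x), e α c = cobd h α c
  red : ∀ (Z : QRep k H) (e' : Cocycle Z C), Red e' e ∨ Red e e'
  sub : ∀ (U : ∀ x, Submodule k (C.X x)) (hU : C.Stable U),
    (∃ h : Fam (C.sub U hU) M, ∀ ⦃x y : V⦄ (α : H x y) (c : U x),
      e α c = M.map α (h x c) - h y ⟨C.map α c, hU α c c.2⟩) ∨ ∀ x, U x = ⊤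

theorem SES.exists_splitting {A B C : QRep k H} {i : Fam A B} {p : Fam B C} (h : SES i p) :
    ∃ (r : Fam B A) (s : Fam C B), (∀ x a, r x (i x a) = a) ∧ (∀ x c, p x (s x c) = c) ∧
      ∀ x b, i x (r x b) + s x (p x b) = b := by
  choose r hr using fun x => LinearMap.exists_leftInverse_of_injective (i x)
    (LinearMap.ker_eq_bot.2 (h.inj x))
  choose t ht using fun x => LinearMap.exists_rightInverse_of_surjective (p x)
    (LinearMap.range_eq_top.2 (h.surj x))
  have hr' : ∀ x a, r x (i x a) = a := fun x a => LinearMap.congr_fun (hr x) a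
  have ht' : ∀ x c, p x (t x c) = c := fun x c => LinearMap.congr_fun (ht x) c
  refine ⟨r, fun x => t x - i x ∘ₗ r x ∘ₗ t x, hr', fun x c => by simp [ht', h.zero], ?_⟩
  intro x b
  obtain ⟨a, ha⟩ := h.exact x (b - t x (p x b)) (by simp [ht'])
  have h1 : r x b = a + r x (t x (p x b)) := by
    rw [← hr' x a, ← map_add, ha, sub_add_cancel]
  simp only [LinearMap.sub_apply, LinearMap.comp_apply, h1, map_add, ha]
  abel

theorem Irr.exists_crit {M N C : QRep k H} {f : Fam M N} {p : Fam N C} (hf : Irr f)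
    (h : SES f p) : ∃ e : Cocycle M C, Crit e := by
  obtain ⟨r, s, hr, hs, hrs⟩ := h.exists_splitting
  let e : Cocycle M C := fun x y α => r y ∘ₗ N.map α ∘ₗ s x
  have he : ∀ ⦃x y : V⦄ (α : H x y) (c : C.X x),
      N.map α (s x c) = f y (e α c) + s y (C.map α c) := by
    intro x y α c
    have h1 := hrs y (N.map α (s x c))
    rw [h.hom_p α, hs] at h1
    exact h1.symm
  have pull : ∀ (X : QRep k H) (u : Fam X C), IsHom u →
      (∃ t : Fam X M, ∀ ⦃x y : V⦄ (α : H x y) (v : X.X x),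
        e α (u x v) = M.map α (t x v) - t y (X.map α v)) ∨
      ∃ g : Fam N X, IsHom g ∧ ∀ x n, u x (g x n) = p x n := by
    intro X u hu
    let e' : Cocycle M X := fun x y α => e α ∘ₗ u x
    rcases hf.factor (extRep e') (fun x => LinearMap.inl k _ _)
      (fun x => (f x).coprod (s x ∘ₗ u x)) (fun x y α m => by simp) (fun x y α v => by
        simp [e', hf.hom α, hu α, he, add_assoc]) (fun x m => by simp) with ⟨q, hq, hq1⟩ | ⟨q, hq, hq1⟩
    · left
      refine ⟨fun x => q x ∘ₗ LinearMap.inr k _ _, fun x y α v => ?_⟩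
      have h1 := hq α (0, v)
      have h2 : (extRep e').map α (0, v) = (e α (u x v), 0) + (0, X.map α v) := by simp [e']
      have h3 : q y (e α (u x v), 0) = e α (u x v) := hq1 y _
      rw [h2, map_add, h3] at h1
      exact eq_sub_of_add_eq h1
    · right
      refine ⟨fun x => LinearMap.snd k _ _ ∘ₗ q x, fun x y α n => ?_, fun x n => ?_⟩
      · have h1 := hq α n
        exact congrArg Prod.snd h1
      · have h1 := congrArg (p x) (hq1 x n)
        simpa [h.zero, hs] using h1
  refine ⟨e, ⟨?_, ?_, ?_⟩⟩
  · rintro ⟨t, ht⟩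
    refine hf.not_mono ⟨fun x => r x + t x ∘ₗ p x, fun x y α n => h.inj y ?_, fun x m => by
      simp [hr, h.zero]⟩
    have key : ∀ x n, f x (r x n) = n - s x (p x n) := fun x n => eq_sub_of_add_eq (hrs x n)
    have h1 := ht α (p x n)
    rw [cobd_apply, ← h.hom_p α] at h1
    simp only [LinearMap.add_apply, LinearMap.comp_apply, map_add, key]
    rw [hf.hom α, hf.hom α, key, map_sub, he, h1, map_sub, hf.hom α, h.hom_p α]
    abel
  · intro Z e'
    rcases pull (extRep e') (fun x => LinearMap.snd k _ _) (fun x y α v => rfl) with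
      ⟨t, ht⟩ | ⟨g, hg, hg1⟩
    · left
      refine ⟨fun x => - (t x ∘ₗ LinearMap.inl k _ _), fun x y α z => ?_,
        fun x => - (t x ∘ₗ LinearMap.inr k _ _), fun x y α c => ?_⟩
      · have h1 := ht α (z, 0)
        change e α 0 = _ at h1
        have h2 : (extRep e').map α (z, 0) = (Z.map α z, 0) := by simp
        rw [h2, map_zero, eq_comm, sub_eq_zero] at h1
        simp [h1]
      · have h1 := ht α (0, c)
        have h2 : (extRep e').map α (0, c) = (e' α c, 0) + (0, C.map α c) := by simp
        rw [h2, map_add] at h1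
        change e α c = _ at h1
        rw [cobd_apply, h1]
        simp only [LinearMap.neg_apply, LinearMap.comp_apply, LinearMap.inl_apply,
          LinearMap.inr_apply, map_neg]
        abel
    · right
      have hg2 : ∀ x n, (g x n).2 = p x n := hg1
      have hg3 : ∀ ⦃x y : V⦄ (α : H x y) (n : N.X x),
          (g y (N.map α n)).1 = Z.map α (g x n).1 + e' α (p x n) := by
        intro x y α n
        have h1 := congrArg Prod.fst (hg α n)
        rw [← hg2]
        exact h1
      refine ⟨fun x => LinearMap.fst k _ _ ∘ₗ g x ∘ₗ f x, fun x y α m => ?_,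
        fun x => LinearMap.fst k _ _ ∘ₗ g x ∘ₗ s x, fun x y α c => ?_⟩
      · change (g y (f y (M.map α m))).1 = Z.map α (g x (f x m)).1
        rw [hf.hom α, hg3, h.zero, map_zero, add_zero]
      · change (g y (f y (e α c))).1 =
          e' α c + (Z.map α (g x (s x c)).1 - (g y (s y (C.map α c))).1)
        have h1 : f y (e α c) = N.map α (s x c) - s y (C.map α c) := by rw [he]; abel
        rw [h1, map_sub, Prod.fst_sub, hg3, hs]
        abel
  · intro U hU
    rcases pull _ (C.subι U hU) (C.isHom_subι U hU) with ⟨t, ht⟩ | ⟨g, -, hg⟩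
    · exact Or.inl ⟨t, ht⟩
    · right
      intro x
      rw [eq_top_iff]
      intro c _
      have h1 := hg x (s x c)
      rw [hs] at h1
      rw [← h1]
      exact (g x (s x c)).2

/-- The equations for the vanishing of a coboundary, along one arrow. -/
def cobdEq (M C : QRep k H) (j : Σ x y, H x y) :
    (∀ x, C.X x →ₗ[k] M.X x) →ₗ[k] (C.X j.1 →ₗ[k] M.X j.2.1) where
  toFun h := cobd h j.2.2
  map_add' h h' := by
    apply LinearMap.ext
    intro c
    simp only [cobd_apply, LinearMap.add_apply, Pi.add_apply, map_add]
    abel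
  map_smul' a h := by
    apply LinearMap.ext
    intro c
    simp [cobd_apply, smul_sub]

theorem cobdEq_dependsFin (M C : QRep k H) (j : Σ x y, H x y) :
    DependsFin (cobdEq M C j) := by
  classical
  refine ⟨{j.1, j.2.1}, fun h hh => ?_⟩
  apply LinearMap.ext
  intro c
  change M.map j.2.2 (h j.1 c) - h j.2.1 (C.map j.2.2 c) = 0
  rw [hh j.1 (by simp), hh j.2.1 (by simp)]
  simp

theorem Crit.exists_finset {M C : QRep k H} {e : Cocycle M C} (he : Crit e) :
    ∃ F : Finset (Σ x y, H x y), ¬ ∃ h : Fam C M, ∀ j ∈ F, e j.2.2 = cobd h j.2.2 := by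
  by_contra hF
  push Not at hF
  obtain ⟨h, hh⟩ := exists_solution (cobdEq M C) (fun j => e j.2.2) (cobdEq_dependsFin M C)
    fun F => (hF F).imp fun h hh j hj => (hh j hj).symm
  exact he.nonsplit ⟨h, fun x y α c => (LinearMap.congr_fun (hh ⟨x, y, α⟩) c).symm⟩

variable [SLF H]

variable (k H) in
/-- The projective representation attached to a vertex. -/
noncomputable abbrev proj (x : V) : QRep k H where
  X y := Pth H x y →₀ k
  map α := Finsupp.lmapDomain k k fun p => p.cons α

/-- The cocycle with values in a projective representation attached to a functional. -/
noncomputable def topCocycle {C : QRep k H} {x : V}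
    (t : (∀ a : Σ y, H y x, C.X a.1) →ₗ[k] k) : Cocycle (proj k H x) C :=
  open Classical in
  fun y z α => if h : z = x then
    Finsupp.lsingle (h ▸ Pth.nil : Pth H x z) ∘ₗ t ∘ₗ
      LinearMap.single k (fun a : Σ y, H y x => C.X a.1) ⟨y, h ▸ α⟩
  else 0

open Classical in
theorem topCocycle_self {C : QRep k H} {x y : V} (t : (∀ a : Σ y, H y x, C.X a.1) →ₗ[k] k)
    (α : H y x) (c : C.X y) : topCocycle t α c =
      Finsupp.single Pth.nil (t (Pi.single (M := fun a : Σ y, H y x => C.X a.1) ⟨y, α⟩ c)) := by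
  unfold topCocycle
  rw [dif_pos rfl]
  rfl

theorem topCocycle_of_ne {C : QRep k H} {x y z : V} (t : (∀ a : Σ y, H y x, C.X a.1) →ₗ[k] k)
    (α : H y z) (h : z ≠ x) : topCocycle t α = 0 := by
  unfold topCocycle
  rw [dif_neg h]

theorem Crit.fpres {M C : QRep k H} {e : Cocycle M C} (he : Crit e)
    (hfin : {x | ∃ θ : Fam M (proj k H x), IsHom θ ∧ θ x ≠ 0}.Finite) : C.FPres := by
  classical
  obtain ⟨F, hF⟩ := he.exists_finset
  let S : Set V := (F.image fun j => j.1 : Finset V) ∪ (F.image fun j => j.2.1 : Finset V)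
  have hS : S.Finite := (Finset.finite_toSet _).union (Finset.finite_toSet _)
  have hS1 : ∀ j ∈ F, j.1 ∈ S := fun j hj => Or.inl (Finset.mem_image_of_mem _ hj)
  have hS2 : ∀ j ∈ F, j.2.1 ∈ S := fun j hj => Or.inr (Finset.mem_image_of_mem (fun j => j.2.1) hj)
  have hgen : C.GenBy S := by
    intro U hU hUS
    refine (he.sub U hU).resolve_left ?_
    rintro ⟨h, hh⟩
    choose h' hh' using fun x => LinearMap.exists_extend (p := U x) (h x)
    have hx : ∀ x (c : U x), h' x c = h x c := fun x c => LinearMap.congr_fun (hh' x) c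
    refine hF ⟨h', fun j hj => LinearMap.ext fun c => ?_⟩
    have hc : c ∈ U j.1 := by rw [hUS _ (hS1 j hj)]; exact Submodule.mem_top
    have h1 := hh j.2.2 ⟨c, hc⟩
    rw [← hx, ← hx] at h1
    exact h1
  refine ⟨S ∪ _, hS.union hfin, fun x hx => hgen.eq_zero fun h' =>
    hx (succs_mono Set.subset_union_left h'), fun x hx => ⟨?_, hgen.inc_surjective fun h' =>
    hx (.inl h')⟩⟩
  rw [injective_iff_map_eq_zero]
  intro w hw
  rw [← Module.forall_dual_apply_eq_zero_iff k]
  intro t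
  rcases he.red _ (topCocycle t) with ⟨θ, -, h, hh⟩ | ⟨θ, hθ, h, hh⟩
  · exfalso
    refine hF ⟨fun x => - h x, fun j hj => LinearMap.ext fun c => ?_⟩
    have hne : j.2.1 ≠ x := fun h' => hx (.inl (h' ▸ hS2 j hj))
    have h1 := hh j.2.2 c
    rw [topCocycle_of_ne t j.2.2 hne, LinearMap.zero_apply, map_zero] at h1
    rw [eq_neg_of_add_eq_zero_left h1.symm, cobd_apply, cobd_apply]
    simp only [LinearMap.neg_apply, map_neg]
    abel
  · have hθx : θ x = 0 := by
      by_contra h'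
      exact hx (.inr ⟨θ, hθ, h'⟩)
    have key : ∀ a : Σ y, H y x, ∀ c : C.X a.1, Finsupp.single (Pth.nil : Pth H x x)
        (t (Pi.single (M := fun a : Σ y, H y x => C.X a.1) a c)) = h x (C.map a.2 c) := by
      rintro ⟨y, α⟩ c
      have h1 := hh α c
      have := isEmpty_path_of_arrow α
      have h2 : h y c = 0 := Subsingleton.elim (α := Pth H x y →₀ k) _ _
      rw [hθx, topCocycle_self, cobd_apply, h2, map_zero, zero_sub, LinearMap.zero_apply,
        eq_comm, ← sub_eq_add_neg, sub_eq_zero] at h1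
      exact h1
    have h1 : Finsupp.single (Pth.nil : Pth H x x) (t w) = 0 := by
      have h2 : w = ∑ a, Pi.single (M := fun a : Σ y, H y x => C.X a.1) a (w a) :=
        (Finset.univ_sum_single w).symm
      conv_lhs => rw [h2]
      rw [map_sum, Finsupp.single_finsetSum, Finset.sum_congr rfl fun a _ => key a (w a), ← map_sum,
        ← inc_apply, hw, map_zero]
    exact Finsupp.single_eq_zero.1 h1

end QRep

end Extensions

section Projectives

namespace QRep

variable {k : Type} [Field k] {V : Type} {H : V → V → Type}

/-- The action of a path on an element. -/
def act (M : QRep k H) {x : V} (m : M.X x) : ∀ {y : V}, Pth H x y → M.X y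
  | _, .nil => m
  | _, .cons p α => M.map α (act M m p)

variable [SLF H]

/-- The morphism from a projective representation attached to an element. -/
noncomputable def ofElem (M : QRep k H) {x : V} (m : M.X x) : Fam (proj k H x) M :=
  fun _ => Finsupp.linearCombination k (M.act m)

theorem ofElem_single (M : QRep k H) {x y : V} (m : M.X x) (p : Pth H x y) (a : k) :
    M.ofElem m y (Finsupp.single p a) = a • M.act m p :=
  Finsupp.linearCombination_single _ _ _

theorem isHom_ofElem (M : QRep k H) {x : V} (m : M.X x) : IsHom (M.ofElem m) := by
  intro y z α v
  induction v using Finsupp.induction_linear with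
  | zero => simp
  | add v w hv hw => rw [map_add, map_add, hv, hw, map_add, map_add]
  | single p a =>
    rw [ofElem_single, Finsupp.lmapDomain_apply, Finsupp.mapDomain_single, ofElem_single, map_smul]
    rfl

omit [SLF H] in
theorem IsHom.act {M N : QRep k H} {φ : Fam M N} (hφ : IsHom φ) {x y : V} (m : M.X x)
    (p : Pth H x y) : φ y (M.act m p) = N.act (φ x m) p := by
  induction p with
  | nil => rfl
  | cons p α ih => exact (hφ α _).trans (congrArg _ ih)

theorem act_proj {x y : V} (p : Pth H x y) :
    (proj k H x).act (Finsupp.single Pth.nil (1 : k)) p = Finsupp.single p 1 := by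
  induction p with
  | nil => rfl
  | cons p α ih =>
    change (proj k H x).map α ((proj k H x).act (Finsupp.single Pth.nil (1 : k)) p) = _
    rw [ih, Finsupp.lmapDomain_apply, Finsupp.mapDomain_single]

theorem Loc.bijective_of_top {M : QRep k H} (hM : Loc M) {x : V} {θ : Fam M (proj k H x)}
    (hθ : IsHom θ) (h : θ x ≠ 0) (y : V) : Function.Bijective (θ y) := by
  obtain ⟨m', hm'⟩ : ∃ m', θ x m' ≠ 0 := by
    by_contra! h'
    exact h (LinearMap.ext h')
  obtain ⟨a, ha⟩ : ∃ a : k, θ x m' = Finsupp.single Pth.nil a := by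
    refine ⟨θ x m' Pth.nil, Finsupp.ext fun p => ?_⟩
    rw [eq_nil_of_loop p, Finsupp.single_eq_same]
  have ha0 : a ≠ 0 := by
    rintro rfl
    exact hm' (by rw [ha, Finsupp.single_zero])
  let m := a⁻¹ • m'
  have hm : θ x m = Finsupp.single Pth.nil 1 := by
    simp only [m]
    rw [map_smul, ha, Finsupp.smul_single, smul_eq_mul, inv_mul_cancel₀ ha0]
  have h1 : ∀ y v, θ y (M.ofElem m y v) = v := by
    intro y v
    induction v using Finsupp.induction_linear with
    | zero => simp
    | add v w hv hw => rw [map_add, map_add, hv, hw]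
    | single p a =>
      rw [ofElem_single, map_smul, hθ.act, hm, act_proj, Finsupp.smul_single, smul_eq_mul, mul_one]
  refine ⟨?_, fun v => ⟨_, h1 y v⟩⟩
  rcases hM _ ((M.isHom_ofElem m).cmp hθ) with h2 | h2
  · rw [injective_iff_map_eq_zero]
    intro n hn
    exact h2 y n (by rw [LinearMap.comp_apply, hn, map_zero])
  · exfalso
    have h3 : m = 0 := h2 x m (by
      rw [LinearMap.comp_apply, hm, ofElem_single, one_smul]; rfl)
    rw [h3, map_zero, eq_comm, Finsupp.single_eq_zero] at hm
    exact one_ne_zero hm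

variable (k H) in
theorem fpres_proj (x : V) : (proj k H x).FPres := by
  classical
  refine ⟨{x}, Set.finite_singleton x, fun y hy v => ?_, fun y hy => ⟨?_, fun v => ?_⟩⟩
  · have : IsEmpty (Pth H x y) := ⟨fun p => hy ⟨x, rfl, ⟨p⟩⟩⟩
    exact Subsingleton.elim (α := Pth H x y →₀ k) _ _
  · rw [injective_iff_map_eq_zero]
    intro w hw
    funext a
    refine Finsupp.ext fun q => ?_
    have h1 : (proj k H x).inc y w (q.cons a.2) = w a q := by
      rw [inc_apply, Finsupp.finsetSum_apply, Finset.sum_eq_single a]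
      · refine Finsupp.mapDomain_apply (fun p p' h => ?_) _ _
        simpa using h
      · intro b _ hb
        refine Finsupp.mapDomain_of_notMem_range _ _ ?_
        rintro ⟨p, hp⟩
        apply hb
        obtain ⟨b1, b2⟩ := b
        obtain ⟨a1, a2⟩ := a
        simp only [Pth.cons.injEq] at hp
        obtain ⟨rfl, -, hp⟩ := hp
        rw [eq_of_heq hp]
      · simp
    rw [← h1, hw]
    rfl
  · change v ∈ LinearMap.range ((proj k H x).inc y)
    induction v using Finsupp.induction_linear with
    | zero => exact Submodule.zero_mem _
    | add v w hv hw => exact Submodule.add_mem _ hv hw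
    | single p a =>
      cases p with
      | nil => exact absurd rfl hy
      | cons p α =>
        have := (proj k H x).map_mem_range_inc α (Finsupp.single p a)
        rwa [Finsupp.lmapDomain_apply, Finsupp.mapDomain_single] at this

/-- Finitely many indecomposable projective representations are tops of `M`. -/
def TopFin (M : QRep k H) : Prop := {x | ∃ θ : Fam M (proj k H x), IsHom θ ∧ θ x ≠ 0}.Finite

theorem Loc.topFin {M : QRep k H} (hM : Loc M) : TopFin M := by
  refine Set.Subsingleton.finite ?_
  have key : ∀ x y, (∃ θ : Fam M (proj k H x), IsHom θ ∧ θ x ≠ 0) →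
      (∃ θ : Fam M (proj k H y), IsHom θ ∧ θ y ≠ 0) → Nonempty (Pth H x y) := by
    rintro x y ⟨θ, hθ, h⟩ ⟨θ', hθ', h'⟩
    by_contra hp
    apply h'
    apply LinearMap.ext
    intro m
    have h1 : m = 0 := by
      have := hM.bijective_of_top hθ h y
      apply this.1
      have : IsEmpty (Pth H x y) := not_nonempty_iff.1 hp
      exact Subsingleton.elim (α := Pth H x y →₀ k) _ _
    rw [h1, map_zero, map_zero]
  intro x hx y hy
  obtain ⟨p⟩ := key x y hx hy
  obtain ⟨q⟩ := key y x hy hx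
  exact eq_of_paths p q

theorem Irr.fpres {M N C : QRep k H} {f : Fam M N} {p : Fam N C} (hf : Irr f) (h : SES f p)
    (hM : TopFin M) : C.FPres := by
  obtain ⟨e, he⟩ := hf.exists_crit h
  exact he.fpres hM

end QRep

end Projectives

section Duality

namespace QRep

variable {k : Type} [Field k] {V : Type} {H : V → V → Type}

/-- The transpose of a family defined on a dual. -/
noncomputable def flipL {M : QRep k H} {X : QRep k (Opp H)} (g : Fam M.dual X) :
    Fam (M := (X.dual : QRep k H)) M :=
  fun x => (Module.evalEquiv k (M.X x)).symm.toLinearMap ∘ₗ (g x).dualMap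

/-- The transpose of a family with values in a dual. -/
def flipR {M : QRep k H} {X : QRep k (Opp H)} (h : Fam X M.dual) :
    Fam M (X.dual : QRep k H) :=
  fun x => LinearMap.flip (h x)

theorem flipL_apply {M : QRep k H} {X : QRep k (Opp H)} (g : Fam M.dual X) {x : V}
    (ξ : Module.Dual k (M.X x)) (η : Module.Dual k (X.X x)) : ξ (flipL g x η) = η (g x ξ) :=
  Module.apply_evalEquiv_symm_apply k (M.X x) ξ _

theorem flipR_apply {M : QRep k H} {X : QRep k (Opp H)} (h : Fam X M.dual) {x : V}
    (m : M.X x) (v : X.X x) : (flipR h x m : Module.Dual k (X.X x)) v =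
      (h x v : Module.Dual k (M.X x)) m := rfl

theorem eq_of_dual {M : QRep k H} {x : V} {m m' : M.X x}
    (h : ∀ ξ : Module.Dual k (M.X x), ξ m = ξ m') : m = m' := by
  rw [← sub_eq_zero, ← Module.forall_dual_apply_eq_zero_iff k]
  intro ξ
  rw [map_sub, h, sub_self]

theorem IsHom.flipL {M : QRep k H} {X : QRep k (Opp H)} {g : Fam M.dual X} (hg : IsHom g) :
    IsHom (flipL g) := by
  intro x y α η
  refine eq_of_dual fun ξ => ?_
  rw [flipL_apply]
  have h1 := hg (show Opp H y x from α) ξ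
  have h2 := flipL_apply g (LinearMap.dualMap (M.map α) ξ) η
  rw [LinearMap.dualMap_apply] at h2
  rw [h2]
  exact (congrArg (fun v => η v) h1).symm

theorem IsHom.flipR {M : QRep k H} {X : QRep k (Opp H)} {h : Fam X M.dual} (hh : IsHom h) :
    IsHom (flipR h) := by
  intro x y α m
  apply LinearMap.ext
  intro v
  exact (LinearMap.congr_fun (hh (show Opp H y x from α) v) m).symm

/-- The family whose dual is a given family. -/
noncomputable def undual {M N : QRep k H} (g : Fam M.dual N.dual) : Fam N M :=
  cmp (flipL g) (flipR (idf N.dual))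

theorem IsHom.undual {M N : QRep k H} {g : Fam M.dual N.dual} (hg : IsHom g) :
    IsHom (undual g) := hg.flipL.cmp (isHom_id N.dual).flipR

theorem undual_apply {M N : QRep k H} (g : Fam M.dual N.dual) {x : V}
    (ξ : Module.Dual k (M.X x)) (n : N.X x) :
    ξ (undual g x n) = (g x ξ : Module.Dual k (N.X x)) n := flipL_apply g ξ _

theorem Irr.dual {M N : QRep k H} {f : Fam M N} (hf : Irr f) : Irr (dualF f) where
  hom := hf.hom.dual
  not_mono := by
    rintro ⟨r, hr, hr1⟩
    refine hf.not_epi ⟨undual r, hr.undual, fun x n => eq_of_dual fun ν => ?_⟩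
    rw [← LinearMap.dualMap_apply, undual_apply]
    exact LinearMap.congr_fun (hr1 x ν) n
  not_epi := by
    rintro ⟨s, hs, hs1⟩
    refine hf.not_mono ⟨undual s, hs.undual, fun x m => eq_of_dual fun ξ => ?_⟩
    rw [undual_apply]
    exact LinearMap.congr_fun (hs1 x ξ) m
  factor X g h hg hh hgh := by
    rcases hf.factor X.dual (flipR h) (flipL g) hh.flipR hg.flipL (fun x m =>
      eq_of_dual fun ν => by
        rw [flipL_apply, flipR_apply, hgh]; rfl) with ⟨r, hr, hr1⟩ | ⟨s, hs, hs1⟩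
    · right
      refine ⟨flipL (M := X) (X := M) r, IsHom.flipL (M := X) (X := M) hr, fun x ξ =>
        LinearMap.ext fun m => ?_⟩
      rw [← flipR_apply h]
      exact (flipL_apply (M := X) (X := M) r _ _).trans (by rw [hr1])
    · left
      refine ⟨flipR (M := X) (X := N) s, IsHom.flipR (M := X) (X := N) hs, fun x ν =>
        LinearMap.ext fun n => ?_⟩
      refine (flipR_apply (M := X) (X := N) s (g x ν) n).trans ?_
      rw [← flipL_apply, hs1]

theorem Loc.dual {N : QRep k H} (hN : Loc N) : Loc N.dual := by
  intro θ hθ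
  rcases hN _ hθ.undual with h | h
  · left
    intro x ξ hξ
    apply LinearMap.ext
    intro n
    obtain ⟨n, rfl⟩ := (bijective_of_injective _ h x).2 n
    rw [undual_apply, hξ]
    rfl
  · right
    intro x ξ hξ
    apply LinearMap.ext
    intro n
    obtain ⟨n, rfl⟩ := (bijective_of_injective (M := N) (fun x => LinearMap.id - undual θ x)
      (fun x m hm => h x m (sub_eq_zero.1 hm).symm) x).2 n
    rw [LinearMap.sub_apply, map_sub, undual_apply, hξ]
    exact sub_self _

variable [SLF H]

theorem TopFin.dual_prd {M N : QRep k H} (hM : TopFin M.dual) (hN : TopFin N.dual) :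
    TopFin (M.prd N).dual := by
  refine (Set.Finite.union hM hN).subset ?_
  rintro x ⟨θ, hθ, hx⟩
  by_contra h'
  rw [Set.mem_union, not_or] at h'
  have h1 : θ x ∘ₗ dualF (fstF M N) x = 0 := by
    by_contra h
    exact h'.1 ⟨_, hθ.cmp (isHom_fst M N).dual, h⟩
  have h2 : θ x ∘ₗ dualF (sndF M N) x = 0 := by
    by_contra h
    exact h'.2 ⟨_, hθ.cmp (isHom_snd M N).dual, h⟩
  apply hx
  apply LinearMap.ext
  intro ξ
  have h3 : ξ = dualF (fstF M N) x (ξ ∘ₗ LinearMap.inl k _ _) +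
      dualF (sndF M N) x (ξ ∘ₗ LinearMap.inr k _ _) := by
    apply LinearMap.ext
    rintro ⟨m, n⟩
    change ξ (m, n) = ξ (m, 0) + ξ (0, n)
    rw [← map_add, Prod.mk_add_mk, add_zero, zero_add]
  rw [h3, map_add]
  have h4 := LinearMap.congr_fun h1 (ξ ∘ₗ LinearMap.inl k _ _)
  have h5 := LinearMap.congr_fun h2 (ξ ∘ₗ LinearMap.inr k _ _)
  exact (congrArg₂ (· + ·) h4 h5).trans (add_zero _)

theorem Irr.dual_fpres {K M N : QRep k H} {i : Fam K M} {f : Fam M N} (hf : Irr f)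
    (h : SES i f) (hN : TopFin N.dual) : K.dual.FPres :=
  hf.dual.fpres h.dual hN

end QRep

end Duality

section Truncation

namespace QRep

variable {k : Type} [Field k] {V : Type} {H : V → V → Type}

/-- A cocycle that does not split and is comparable with every other one under pushouts. -/
structure Comparable {M C : QRep k H} (e : Cocycle M C) : Prop where
  nonsplit : ¬ ∃ h : Fam C M, ∀ ⦃x y : V⦄ (α : H x y) (c : C.X x), e α c = cobd h α c
  red : ∀ (Z : QRep k H) (e' : Cocycle Z C), Red e' e ∨ Red e e'

theorem cobd_add {M C : QRep k H} (h h' : Fam C M) {x y : V} (α : H x y) (c : C.X x) :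
    cobd (fun z => h z + h' z) α c = cobd h α c + cobd h' α c := by
  simp only [cobd_apply, LinearMap.add_apply, map_add]
  abel

theorem cobd_neg {M C : QRep k H} (h : Fam C M) {x y : V} (α : H x y) (c : C.X x) :
    cobd (fun z => - h z) α c = - cobd h α c := by
  simp only [cobd_apply, LinearMap.neg_apply, map_neg]
  abel

theorem map_cobd {M N C : QRep k H} {φ : Fam M N} (hφ : IsHom φ) (h : Fam C M) {x y : V}
    (α : H x y) (c : C.X x) : φ y (cobd h α c) = cobd (cmp φ h) α c := by
  rw [cobd_apply, cobd_apply, map_sub, hφ α]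
  rfl

theorem Comparable.sub_cobd {M C : QRep k H} {e : Cocycle M C} (he : Comparable e) (h : Fam C M) :
    Comparable (fun _ _ α => e α - cobd h α : Cocycle M C) where
  nonsplit := by
    rintro ⟨h', hh'⟩
    refine he.nonsplit ⟨fun x => h x + h' x, fun x y α c => ?_⟩
    rw [cobd_add, ← hh']
    simp
  red Z e' := by
    rcases he.red Z e' with ⟨θ, hθ, h', hh'⟩ | ⟨θ, hθ, h', hh'⟩
    · refine Or.inl ⟨θ, hθ, fun x => h x + h' x, fun x y α c => ?_⟩
      rw [cobd_add, hh']
      simp only [LinearMap.sub_apply]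
      abel
    · refine Or.inr ⟨θ, hθ, fun x => h' x + - cmp θ h x, fun x y α c => ?_⟩
      rw [cobd_add h' (fun x => - cmp θ h x), cobd_neg, LinearMap.sub_apply, map_sub, hh',
        map_cobd hθ]
      abel

theorem Loc.injective_of_fix {M C : QRep k H} (hM : Loc M) {e : Cocycle M C}
    (he : Comparable e) {Ψ : Fam M M} (hΨ : IsHom Ψ) {h : Fam C M}
    (heq : ∀ ⦃x y : V⦄ (α : H x y) (c : C.X x), Ψ y (e α c) = e α c + cobd h α c) :
    ∀ x m, Ψ x m = 0 → m = 0 := by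
  refine (hM Ψ hΨ).resolve_right fun h1 => he.nonsplit ?_
  let D : Fam M M := fun x => LinearMap.id - Ψ x
  have hD : IsHom D := (isHom_id M).sub hΨ
  obtain ⟨g, hg, hg1, -⟩ := exists_inverse hD (bijective_of_injective D fun x m hm =>
    h1 x m (sub_eq_zero.1 hm).symm)
  refine ⟨fun x => - cmp g h x, fun x y α c => ?_⟩
  have h2 : D y (e α c) = - cobd h α c := by
    rw [LinearMap.sub_apply, heq, LinearMap.id_apply]
    abel
  rw [cobd_neg, ← map_cobd hg, ← map_neg, ← h2, hg1]

open Classical in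
/-- The submodules that are everything on `R` and zero off `R`. -/
noncomputable def region (R : Set V) (M : QRep k H) (x : V) : Submodule k (M.X x) :=
  if x ∈ R then ⊤ else ⊥

theorem exists_region_proj (R : Set V) (M : QRep k H) :
    ∃ pr : ∀ x, M.X x →ₗ[k] M.region R x, (∀ x (z : M.region R x), pr x z = z) ∧
      (∀ x ∈ R, ∀ m, (pr x m : M.X x) = m) ∧ ∀ x ∉ R, ∀ z : M.region R x, z = 0 := by
  choose pr hpr using fun x => LinearMap.exists_leftInverse_of_injective (M.region R x).subtype
    (Submodule.ker_subtype _)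
  have h1 : ∀ x (z : M.region R x), pr x z = z := fun x z => LinearMap.congr_fun (hpr x) z
  refine ⟨pr, h1, fun x hx m => ?_, fun x hx z => ?_⟩
  · have hm : m ∈ M.region R x := by
      rw [region, if_pos hx]
      exact Submodule.mem_top
    exact congrArg Subtype.val (h1 x ⟨m, hm⟩)
  · have hz : (z : M.X x) ∈ (⊥ : Submodule k (M.X x)) := (if_neg hx : M.region R x = ⊥) ▸ z.2
    exact Subtype.ext hz

theorem Comparable.region {M C : QRep k H} {e : Cocycle M C} (he : Comparable e) (R : Set V) :
    (∃ (Φ : Fam M M) (h : Fam C M), (∀ x ∉ R, Φ x = 0) ∧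
      (∀ ⦃x y : V⦄ (α : H x y) (m : M.X x), x ∈ R → Φ y (M.map α m) = M.map α (Φ x m)) ∧
      ∀ ⦃x y : V⦄ (α : H x y) (c : C.X x), Φ y (e α c) = e α c + cobd h α c) ∨
    ∃ (Θ : Fam M M) (h : Fam C M), (∀ x ∉ R, Θ x = 0 ∧ h x = 0) ∧
      (∀ ⦃x y : V⦄ (α : H x y) (m : M.X x), y ∈ R → Θ y (M.map α m) = M.map α (Θ x m)) ∧
      ∀ ⦃x y : V⦄ (α : H x y) (c : C.X x), y ∈ R → Θ y (e α c) = e α c + cobd h α c := by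
  obtain ⟨pr, hpr, hR, hR'⟩ := M.exists_region_proj R
  let Z : QRep k H :=
    { X := fun x => M.region R x
      map := fun {x y} α => pr y ∘ₗ M.map α ∘ₗ (M.region R x).subtype }
  rcases he.red Z (fun x y α => pr y ∘ₗ e α) with ⟨θ, hθ, h, hh⟩ | ⟨θ, hθ, h, hh⟩
  · refine Or.inl ⟨fun x => θ x ∘ₗ pr x, h, fun x hx => ?_, fun x y α m hx => ?_, hh⟩
    · apply LinearMap.ext
      intro m
      rw [LinearMap.comp_apply, hR' x hx (pr x m), map_zero]
      rfl
    · have h1 := hθ α (pr x m)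
      change θ y (pr y (M.map α (pr x m : M.X x))) = _ at h1
      rwa [hR x hx] at h1
  · refine Or.inr ⟨fun x => (M.region R x).subtype ∘ₗ θ x, fun x => (M.region R x).subtype ∘ₗ h x,
      fun x hx => ⟨?_, ?_⟩, fun x y α m hy => ?_, fun x y α c hy => ?_⟩
    · apply LinearMap.ext
      intro m
      exact congrArg Subtype.val (hR' x hx (θ x m))
    · apply LinearMap.ext
      intro c
      exact congrArg Subtype.val (hR' x hx (h x c))
    · have h1 := congrArg Subtype.val (hθ α m)
      exact h1.trans (hR y hy _)
    · have h1 := congrArg Subtype.val (hh α c)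
      have h2 : ((pr y (e α c) : M.region R y) : M.X y) = e α c := hR y hy _
      have h3 : ((Z.map α (h x c) : M.region R y) : M.X y) = M.map α (h x c) := hR y hy _
      refine h1.trans ?_
      change ((pr y (e α c) : M.region R y) : M.X y) +
        (((Z.map α (h x c) : M.region R y) : M.X y) - (h y (C.map α c) : M.region R y)) = _
      rw [h2, h3]
      rfl

variable [SLF H]

theorem exists_cobd_off {M C : QRep k H} (e : Cocycle M C) {S : Set V} (hS : S.Finite)
    (h0 : ∀ x, x ∉ Succs H S → ∀ c : C.X x, c = 0)
    (h1 : ∀ x, x ∉ S → Function.Bijective (C.inc x)) :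
    ∃ h : Fam C M, ∀ ⦃x y : V⦄ (α : H x y) (c : C.X x), y ∉ S → e α c = cobd h α c := by
  classical
  have hwf := wellFounded_sRel (H := H) hS
  choose g hg using fun y : {y // y ∉ S} =>
    LinearMap.exists_leftInverse_of_injective (C.inc y.1)
      (LinearMap.ker_eq_bot.2 (h1 y.1 y.2).1)
  let step : ∀ y, (∀ x, SRel H S x y → (C.X x →ₗ[k] M.X x)) → (C.X y →ₗ[k] M.X y) := fun y rec =>
    if hy : y ∈ S then 0 else
      (∑ a : Σ x, H x y, (if ha : a.1 ∈ Succs H S then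
        M.map a.2 ∘ₗ rec a.1 ⟨⟨a.2⟩, ha⟩ - e a.2 else 0) ∘ₗ LinearMap.proj a) ∘ₗ g ⟨y, hy⟩
  let h : Fam C M := hwf.fix step
  refine ⟨h, fun x y α c hy => ?_⟩
  have hfix : h y = step y fun x _ => h x := hwf.fix_eq step y
  by_cases hx : x ∈ Succs H S
  · have hcinc : C.map α c = C.inc y (Pi.single (M := fun a : Σ z, H z y => C.X a.1) ⟨x, α⟩ c) :=
      (C.inc_single α c).symm
    have hginc : ∀ w, g ⟨y, hy⟩ (C.inc y w) = w := fun w => LinearMap.congr_fun (hg ⟨y, hy⟩) w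
    have h2 : h y (C.map α c) = M.map α (h x c) - e α c := by
      rw [hfix, hcinc]
      simp only [step, dif_neg hy, LinearMap.comp_apply, hginc, LinearMap.sum_apply]
      rw [Finset.sum_eq_single ⟨x, α⟩]
      · simp [hx]
      · intro b _ hb
        rw [LinearMap.proj_apply, Pi.single_eq_of_ne hb, map_zero]
      · simp
    rw [cobd_apply, h2]
    abel
  · rw [h0 x hx c, map_zero, map_zero]

/-- The equations for an endomorphism fixing an extension class, along one arrow. -/
def fixEq {M C : QRep k H} (e : Cocycle M C) (j : Σ x y, H x y) :
    (∀ x, (M.X x →ₗ[k] M.X x) × (C.X x →ₗ[k] M.X x)) →ₗ[k]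
      (M.X j.1 →ₗ[k] M.X j.2.1) × (C.X j.1 →ₗ[k] M.X j.2.1) :=
  ((cobdEq M M j) ∘ₗ LinearMap.pi fun x => LinearMap.fst k _ _ ∘ₗ LinearMap.proj x).prod
    ((LinearMap.lcomp k (M.X j.2.1) (e j.2.2)) ∘ₗ LinearMap.fst k _ _ ∘ₗ LinearMap.proj j.2.1 -
      (cobdEq M C j) ∘ₗ LinearMap.pi fun x => LinearMap.snd k _ _ ∘ₗ LinearMap.proj x)

omit [SLF H] in
theorem fixEq_apply {M C : QRep k H} (e : Cocycle M C) (j : Σ x y, H x y)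
    (w : ∀ x, (M.X x →ₗ[k] M.X x) × (C.X x →ₗ[k] M.X x)) :
    fixEq e j w = (cobd (fun x => (w x).1) j.2.2,
      (w j.2.1).1 ∘ₗ e j.2.2 - cobd (fun x => (w x).2) j.2.2) := rfl

omit [SLF H] in
theorem fixEq_dependsFin {M C : QRep k H} (e : Cocycle M C) (j : Σ x y, H x y) :
    DependsFin (fixEq e j) := by
  classical
  refine ⟨{j.1, j.2.1}, fun w hw => ?_⟩
  rw [fixEq_apply]
  simp only [cobd]
  rw [hw j.1 (by simp), hw j.2.1 (by simp)]
  simp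

theorem Comparable.false_of_supported {M C : QRep k H} (hM : Loc M) {e : Cocycle M C}
    (he : Comparable e) {S : Set V} (hS : S.Finite)
    (hsupp : ∀ ⦃x y : V⦄ (α : H x y), y ∉ S → e α = 0)
    (hsep : ∀ ⦃x y : V⦄ (α : H x y), x ∉ Succs H S → y ∉ Preds H S → M.map α = 0)
    (hinf : (M.supp ∩ Preds H S).Infinite) (hinf' : (M.supp ∩ Succs H S).Infinite) : False := by
  classical
  have hmid := finite_succs_inter_preds (H := H) hS hS
  obtain ⟨F, hF⟩ := exists_stable_finset (J := {j : Σ x y, H x y // j.2.1 ∈ Preds H S})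
    (fun j => cobdEq M M j.1) (fun j => cobdEq_dependsFin M M j.1) hmid.toFinset
  let S₁ : Set V := (F.image fun j => j.1.1 : Finset V)
  have hS₁ : S₁.Finite := Finset.finite_toSet _
  have hFS₁ : ∀ j ∈ F, j.1.1 ∈ S₁ := fun j hj => Finset.mem_image_of_mem (fun j => j.1.1) hj
  let W : Set V := (Succs H (S₁ ∪ S))ᶜ
  have hWS : ∀ x ∈ Succs H S, x ∉ W := fun x hx h' => h' (succs_mono Set.subset_union_right hx)
  have hWS₁ : ∀ x ∈ S₁, x ∉ W := fun x hx h' => h' (subset_succs _ (Or.inl hx))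
  have hB : ∀ T : Set V, T.Finite → ∃ (Θ : Fam M M) (h : Fam C M),
      (∀ x ∈ W, Θ x = 0 ∧ h x = 0) ∧ (∀ ⦃x y : V⦄ (α : H x y) (m : M.X x), y ∈ T → y ∉ W →
        Θ y (M.map α m) = M.map α (Θ x m)) ∧
      ∀ ⦃x y : V⦄ (α : H x y) (c : C.X x), y ∈ T → y ∉ W →
        Θ y (e α c) = e α c + cobd h α c := by
    intro T hT
    let U : Set V := (Preds H (T ∪ S))ᶜ
    have hU : ∀ x ∈ Preds H S, x ∉ U := fun x hx h' => h' (preds_mono Set.subset_union_right hx)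
    have hUT : ∀ x ∈ T, x ∉ U := fun x hx h' => h' (subset_preds _ (Or.inl hx))
    rcases he.region (W ∪ U)ᶜ with ⟨Φ, h, hΦ0, hΦ, hΦe⟩ | ⟨Θ, h, hΘ0, hΘ, hΘe⟩
    · exfalso
      obtain ⟨Ψ, hΨ, hΨΦ⟩ := hF Φ fun j hj => by
        apply LinearMap.ext
        intro m
        change M.map j.1.2.2 (Φ j.1.1 m) - Φ j.1.2.1 (M.map j.1.2.2 m) = 0
        rw [hΦ j.1.2.2 m, sub_self]
        rintro (h' | h')
        · exact hWS₁ _ (hFS₁ j hj) h'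
        · exact hU _ (preds_arrow j.1.2.2 j.2) h'
      let Ψ' : Fam M M := fun x => if x ∈ Preds H S then Ψ x else Φ x
      have hΨ'mid : ∀ x ∈ Succs H S, Ψ' x = Φ x := by
        intro x hx
        by_cases hx' : x ∈ Preds H S
        · exact (if_pos hx').trans (hΨΦ x (hmid.mem_toFinset.2 ⟨hx, hx'⟩))
        · exact if_neg hx'
      have hΨ'hom : IsHom Ψ' := by
        intro x y α m
        by_cases hy : y ∈ Preds H S
        · have hx := preds_arrow α hy
          simp only [Ψ', if_pos hx, if_pos hy]
          exact (sub_eq_zero.1 (LinearMap.congr_fun (hΨ ⟨⟨x, y, α⟩, hy⟩) m)).symm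
        · by_cases hxs : x ∈ Succs H S
          · rw [hΨ'mid x hxs, hΨ'mid y (succs_arrow α hxs)]
            by_cases hxU : x ∈ U
            · have hyU : y ∈ U := fun h' => hxU (preds_arrow α h')
              rw [hΦ0 x (fun h' => h' (Or.inr hxU)), hΦ0 y (fun h' => h' (Or.inr hyU))]
              simp
            · refine hΦ α m ?_
              rintro (h' | h')
              · exact hWS x hxs h'
              · exact hxU h'
          · rw [hsep α hxs hy]
            simp
      have hinj := hM.injective_of_fix he hΨ'hom (h := h) fun x y α c => by
        by_cases hy : y ∈ S
        · rw [hΨ'mid y (subset_succs S hy), hΦe]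
        · rw [← hΦe, hsupp α hy]
          simp
      obtain ⟨x, ⟨⟨m, hm⟩, hxs⟩, hx⟩ := hinf'.exists_notMem_finite
        (finite_succs_inter_preds (H := H) hS (hT.union hS))
      have hxU : x ∈ U := fun h' => hx ⟨hxs, h'⟩
      refine hm (hinj x m ?_)
      rw [hΨ'mid x hxs, hΦ0 x (fun h' => h' (Or.inr hxU))]
      rfl
    · refine ⟨Θ, h, fun x hx => hΘ0 x fun h' => h' (Or.inl hx), fun x y α m hy hyW =>
        hΘ α m ?_, fun x y α c hy hyW => hΘe α c ?_⟩ <;>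
      exact fun h' => h'.elim hyW (hUT y hy)
  obtain ⟨w, hwW, hw⟩ := exists_solution_mem (fun x => if x ∈ W then ⊥ else ⊤) (fixEq e)
    (fun j => (0, e j.2.2)) (fixEq_dependsFin e) fun F' => by
      obtain ⟨Θ, h, hW, hhom, heq⟩ := hB (F'.image fun j => j.2.1 : Finset V)
        (Finset.finite_toSet _)
      refine ⟨fun x => (Θ x, h x), fun x => ?_, fun j hj => ?_⟩
      · by_cases hx : x ∈ W
        · rw [if_pos hx]
          change (Θ x, h x) ∈ (⊥ : Submodule k _)
          rw [(hW x hx).1, (hW x hx).2]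
          exact Submodule.zero_mem _
        · rw [if_neg hx]
          exact Submodule.mem_top
      · rw [fixEq_apply]
        have hjT : j.2.1 ∈ ((F'.image fun j => j.2.1 : Finset V) : Set V) :=
          Finset.mem_image_of_mem (fun j => j.2.1) hj
        by_cases hy : j.2.1 ∈ W
        · have hx : j.1 ∈ W := fun h' => hy (succs_arrow j.2.2 h')
          have hyS : j.2.1 ∉ S := fun h' => hWS _ (subset_succs S h') hy
          simp only [cobd]
          rw [(hW _ hx).1, (hW _ hx).2, (hW _ hy).1, (hW _ hy).2, hsupp _ hyS]
          simp
        · refine Prod.ext (LinearMap.ext fun m => ?_) (LinearMap.ext fun c => ?_)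
          · exact sub_eq_zero.2 (hhom j.2.2 m hjT hy).symm
          · exact sub_eq_of_eq_add (heq j.2.2 c hjT hy)
  have hinj := hM.injective_of_fix he (Ψ := fun x => (w x).1) (h := fun x => (w x).2)
    (fun x y α m => by
      have h1 := congrArg Prod.fst (hw ⟨x, y, α⟩)
      exact (sub_eq_zero.1 (LinearMap.congr_fun h1 m)).symm)
    (fun x y α c => by
      have h1 := congrArg Prod.snd (hw ⟨x, y, α⟩)
      exact eq_add_of_sub_eq (LinearMap.congr_fun h1 c))
  obtain ⟨x, ⟨⟨m, hm⟩, hxp⟩, hx⟩ := hinf.exists_notMem_finite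
    (finite_succs_inter_preds (H := H) (hS₁.union hS) hS)
  have hxW : x ∈ W := fun h' => hx ⟨h', hxp⟩
  have h1 := hwW x
  rw [if_pos hxW, Submodule.mem_bot] at h1
  refine hm (hinj x m ?_)
  rw [h1]
  rfl

theorem Crit.false_of_infinite {M C : QRep k H} (hM : Loc M) {e : Cocycle M C} (he : Crit e)
    {S : Set V} (hS : S.Finite) (h0 : ∀ x, x ∉ Succs H S → ∀ c : C.X x, c = 0)
    (h1 : ∀ x, x ∉ S → Function.Bijective (C.inc x))
    (hsep : ∀ ⦃x y : V⦄ (α : H x y), x ∉ Succs H S → y ∉ Preds H S → M.map α = 0)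
    (hinf : (M.supp ∩ Preds H S).Infinite) (hinf' : (M.supp ∩ Succs H S).Infinite) : False := by
  obtain ⟨h, hh⟩ := exists_cobd_off e hS h0 h1
  exact (Comparable.sub_cobd ⟨he.nonsplit, he.red⟩ h).false_of_supported hM hS
    (fun x y α hy => LinearMap.ext fun c => sub_eq_zero.2 (hh α c hy)) hsep hinf hinf'

end QRep

end Truncation

section Assembly

namespace QRep

variable {k : Type} [Field k] {V : Type} {H : V → V → Type}

theorem Irr.inj_or_surj {M N : QRep k H} {f : Fam M N} (hf : Irr f) :
    (∀ x, Function.Injective (f x)) ∨ ∀ x, Function.Surjective (f x) := by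
  rcases hf.factor (N.sub (ranF f) hf.hom.stable_ran) (fun x => (f x).rangeRestrict)
    (N.subι _ hf.hom.stable_ran) (fun x y α m => Subtype.ext (hf.hom α m))
    (isHom_subι _ _ _) (fun _ _ => rfl) with ⟨r, -, hr⟩ | ⟨s, -, hs⟩
  · refine Or.inl fun x m m' hm => ?_
    rw [← hr x m, ← hr x m']
    exact congrArg (r x) (Subtype.ext hm)
  · refine Or.inr fun x n => ?_
    obtain ⟨m, hm⟩ := (s x n).2
    exact ⟨m, hm.trans (hs x n)⟩

theorem Irr.comp_bijective {M N N' : QRep k H} {f : Fam M N} (hf : Irr f) {φ : Fam N N'}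
    (hφ : IsHom φ) (hb : ∀ x, Function.Bijective (φ x)) : Irr (cmp φ f) := by
  obtain ⟨ψ, hψ, hψφ, hφψ⟩ := exists_inverse hφ hb
  refine ⟨hφ.cmp hf.hom, ?_, ?_, fun X g h hg hh hgh => ?_⟩
  · rintro ⟨r, hr, hr'⟩
    exact hf.not_mono ⟨cmp r φ, hr.cmp hφ, hr'⟩
  · rintro ⟨s, hs, hs'⟩
    refine hf.not_epi ⟨cmp s φ, hs.cmp hφ, fun x n => (hb x).1 (hs' x (φ x n))⟩
  · refine (hf.factor X g (cmp ψ h) hg (hψ.cmp hh) fun x m => ?_).imp_right ?_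
    · change ψ x (h x (g x m)) = f x m
      rw [hgh]
      exact hψφ x _
    · rintro ⟨s, hs, hs'⟩
      refine ⟨cmp s ψ, hs.cmp hψ, fun x n => ?_⟩
      have h1 := congrArg (φ x) (hs' x (ψ x n))
      exact (hφψ x _).symm.trans (h1.trans (hφψ x n))

theorem Irr.pair_swap {M N₁ N₂ : QRep k H} {f₁ : Fam M N₁} {f₂ : Fam M N₂}
    (hf : Irr (pair f₁ f₂)) : Irr (pair f₂ f₁) :=
  hf.comp_bijective (φ := pair (sndF N₁ N₂) (fstF N₁ N₂)) ((isHom_snd _ _).pair (isHom_fst _ _))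
    fun _ => (LinearEquiv.prodComm k _ _).bijective

theorem ses_prd (M N : QRep k H) :
    SES (A := M) (B := M.prd N) (C := N) (fun _ => LinearMap.inl k _ _) (sndF M N) where
  hom_i _ _ α _ := Prod.ext rfl (map_zero (N.map α)).symm
  hom_p := isHom_snd M N
  inj _ := LinearMap.inl_injective
  surj _ := LinearMap.snd_surjective
  zero _ _ := rfl
  exact _ b hb := ⟨b.1, Prod.ext rfl (Eq.symm hb)⟩

theorem ses_coker_pair {M N₁ N₂ C C₁ : QRep k H} {f₁ : Fam M N₁} {f₂ : Fam M N₂}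
    {p : Fam (N₁.prd N₂) C} {p₁ : Fam N₁ C₁} (h : SES (pair f₁ f₂) p) (h₁ : SES f₁ p₁) :
    ∃ (i : Fam N₂ C) (q : Fam C C₁), SES i q := by
  have hs : ∀ x, ∃ s : C.X x →ₗ[k] (N₁.prd N₂).X x, p x ∘ₗ s = LinearMap.id := fun x =>
    (p x).exists_rightInverse_of_surjective (LinearMap.range_eq_top.2 (h.surj x))
  choose s hs using hs
  have hs' : ∀ x c, p x (s x c) = c := fun x c => LinearMap.congr_fun (hs x) c
  have hwd : ∀ x b b', p x b = p x b' → p₁ x b.1 = p₁ x b'.1 := by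
    intro x b b' hb
    obtain ⟨m, hm⟩ := h.exact x (b - b') (by rw [map_sub, hb, sub_self])
    have h1 := congrArg Prod.fst hm
    change f₁ x m = b.1 - b'.1 at h1
    rw [← sub_eq_zero, ← map_sub, ← h1, h₁.zero]
  refine ⟨fun x => p x ∘ₗ LinearMap.inr k _ _, fun x => p₁ x ∘ₗ LinearMap.fst k _ _ ∘ₗ s x,
    ?_, ?_, fun x => ?_, fun x c => ?_, fun x n => ?_, fun x c hc => ?_⟩
  · intro x y α n
    refine Eq.trans ?_ (h.hom_p α ((0, n) : N₁.X x × N₂.X x))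
    exact congrArg (p y) (Prod.ext (map_zero (N₁.map α)).symm rfl)
  · intro x y α c
    refine Eq.trans (hwd y _ ((N₁.prd N₂).map α (s x c)) ?_) (h₁.hom_p α _)
    rw [hs', h.hom_p, hs']
  · rw [injective_iff_map_eq_zero]
    intro n hn
    obtain ⟨m, hm⟩ := h.exact x _ hn
    have h1 : f₁ x m = 0 := congrArg Prod.fst hm
    have h2 : f₂ x m = n := congrArg Prod.snd hm
    rw [← h2, h₁.inj x (h1.trans (map_zero _).symm), map_zero]
  · obtain ⟨n, rfl⟩ := h₁.surj x c
    refine ⟨p x (n, 0), hwd x _ (n, 0) (hs' x _)⟩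
  · refine (hwd x _ (0, n) (hs' x _)).trans (map_zero _)
  · obtain ⟨m, hm⟩ := h₁.exact x _ hc
    refine ⟨(s x c).2 - f₂ x m, ?_⟩
    refine Eq.trans ?_ (hs' x c)
    change p x (0, (s x c).2 - f₂ x m) = _
    have h1 : ((0, (s x c).2 - f₂ x m) : N₁.X x × N₂.X x) = s x c - pair f₁ f₂ x m :=
      Prod.ext (sub_eq_zero.2 hm.symm).symm rfl
    rw [h1, map_sub, h.zero, sub_zero]

theorem ses_kernels {M N₁ N₂ C : QRep k H} {f₁ : Fam M N₁} {f₂ : Fam M N₂}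
    {p : Fam (N₁.prd N₂) C} (h : SES (pair f₁ f₂) p) (h₁ : IsHom f₁) (h₂ : IsHom f₂)
    (hs₁ : ∀ x, Function.Surjective (f₁ x)) (hs₂ : ∀ x, Function.Surjective (f₂ x)) :
    ∃ (i : Fam ((M.sub (kerF f₁) h₁.stable_ker).prd (M.sub (kerF f₂) h₂.stable_ker)) M)
      (q : Fam M C), SES i q := by
  have hinj : ∀ x m, f₁ x m = 0 → f₂ x m = 0 → m = 0 := fun x m hm hm' =>
    h.inj x ((Prod.ext hm hm' : pair f₁ f₂ x m = 0).trans (map_zero _).symm)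
  have key : ∀ x m, p x (f₁ x m, 0) = - p x (0, f₂ x m) := by
    intro x m
    rw [eq_neg_iff_add_eq_zero, ← map_add]
    refine Eq.trans (congrArg (p x) ?_) (h.zero x m)
    exact Prod.ext (add_zero _) (zero_add _)
  refine ⟨fun x => (kerF f₁ x).subtype.coprod (kerF f₂ x).subtype,
    fun x => p x ∘ₗ LinearMap.inl k _ _ ∘ₗ f₁ x, ?_, ?_, fun x => ?_, fun x c => ?_,
    fun x n => ?_, fun x m hm => ?_⟩
  · intro x y α m
    exact (map_add (M.map α) _ _).symm
  · intro x y α m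
    refine Eq.trans (congrArg (p y) ?_) (h.hom_p α ((f₁ x m, 0) : N₁.X x × N₂.X x))
    exact Prod.ext (h₁ α m) (map_zero (N₂.map α)).symm
  · rw [injective_iff_map_eq_zero]
    rintro ⟨⟨a, ha⟩, ⟨b, hb⟩⟩ hab
    change a + b = 0 at hab
    have hab' := eq_neg_of_add_eq_zero_left hab
    have hb0 : b = 0 := hinj x b (by
      have h1 : f₁ x a = 0 := ha
      rwa [hab', map_neg, neg_eq_zero] at h1) hb
    subst hb0
    refine Prod.ext (Subtype.ext ?_) (Subtype.ext rfl)
    exact hab'.trans neg_zero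
  · obtain ⟨⟨a, b⟩, rfl⟩ := h.surj x c
    obtain ⟨m₂, rfl⟩ := hs₂ x b
    obtain ⟨m, hm⟩ := hs₁ x (a - f₁ x m₂)
    refine ⟨m, ?_⟩
    change p x (f₁ x m, 0) = _
    have h1 : ((f₁ x m, 0) : N₁.X x × N₂.X x) = (a, f₂ x m₂) - pair f₁ f₂ x m₂ :=
      Prod.ext hm (sub_self _).symm
    rw [h1, map_sub, h.zero, sub_zero]
  · obtain ⟨⟨a, ha⟩, ⟨b, hb⟩⟩ := n
    change p x (f₁ x (a + b), 0) = 0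
    have h1 : f₁ x a = 0 := ha
    have h2 : f₂ x b = 0 := hb
    rw [map_add, h1, zero_add, key, h2, ← Prod.zero_eq_mk, map_zero, neg_zero]
  · obtain ⟨m', hm'⟩ := h.exact x _ hm
    have h1 : f₁ x m' = f₁ x m := congrArg Prod.fst hm'
    have h2 : f₂ x m' = 0 := congrArg Prod.snd hm'
    refine ⟨(⟨m - m', ?_⟩, ⟨m', h2⟩), sub_add_cancel m m'⟩
    rw [LinearMap.mem_ker, map_sub, h1, sub_self]

theorem ses_ker_pair {M N₁ N₂ : QRep k H} {f₁ : Fam M N₁} {f₂ : Fam M N₂}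
    (h : IsHom (pair f₁ f₂)) (h₂ : IsHom f₂) (hs : ∀ x, Function.Surjective (pair f₁ f₂ x)) :
    ∃ (i : Fam (M.sub (kerF (pair f₁ f₂)) h.stable_ker) (M.sub (kerF f₂) h₂.stable_ker))
      (q : Fam (M.sub (kerF f₂) h₂.stable_ker) N₁), SES i q := by
  refine ⟨fun x => Submodule.inclusion fun m hm => congrArg Prod.snd hm,
    fun x => f₁ x ∘ₗ (kerF f₂ x).subtype, fun _ _ _ _ => rfl,
    fun x y α m => congrArg Prod.fst (h α m.1), fun x => Submodule.inclusion_injective _,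
    fun x n => ?_, fun x m => congrArg Prod.fst m.2,
    fun x m hm => ⟨⟨m.1, Prod.ext hm m.2⟩, rfl⟩⟩
  obtain ⟨m, hm⟩ := hs x (n, 0)
  exact ⟨⟨m, congrArg Prod.snd hm⟩, congrArg Prod.fst hm⟩

theorem supp_dual (M : QRep k H) : M.dual.supp ⊆ M.supp := by
  rintro x ⟨ξ, hξ⟩
  by_contra hx
  refine hξ (LinearMap.ext fun m => ?_)
  rw [eq_zero_of_notMem_supp hx m, map_zero, map_zero]

variable [SLF H]

theorem dual_fpres_of_finite_supp (M : QRep k H) (h : M.supp.Finite) : M.dual.FPres :=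
  fpres_of_finite_supp _ (h.subset M.supp_dual)

theorem FPres.exists_preds {M : QRep k H} (h : M.dual.FPres) :
    ∃ S : Set V, S.Finite ∧ ∀ x, x ∉ Preds H S → ∀ m : M.X x, m = 0 := by
  obtain ⟨S, hS, h0, -⟩ := h
  rw [succs_opp] at h0
  refine ⟨S, hS, fun x hx m => eq_of_dual fun ξ => ?_⟩
  rw [h0 x hx ξ]
  rfl

theorem Irr.fpres_or_dual_fpres {M N C K D : QRep k H} {f : Fam M N} {p : Fam N C}
    (hf : Irr f) (h : SES f p) (hM : Loc M) {i : Fam K M} {q : Fam M D} (hq : SES i q)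
    (hK : K.dual.FPres) (hD : D.FPres) {j : Fam D C} (hj : ∀ x, Function.Injective (j x)) :
    M.FPres ∨ M.dual.FPres := by
  obtain ⟨e, he⟩ := hf.exists_crit h
  obtain ⟨S, hS, h0, h1⟩ := hf.fpres h hM.topFin
  obtain ⟨T, hT, hT0⟩ := hK.exists_preds
  have hK0 : ∀ x, x ∉ Preds H (S ∪ T) → ∀ a : K.X x, a = 0 := fun x hx =>
    hT0 x fun h' => hx (preds_mono Set.subset_union_right h')
  have hC0 : ∀ x, x ∉ Succs H (S ∪ T) → ∀ c : C.X x, c = 0 := fun x hx =>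
    h0 x fun h' => hx (succs_mono Set.subset_union_left h')
  have hD0 : ∀ x, x ∉ Succs H (S ∪ T) → ∀ d : D.X x, d = 0 := fun x hx d =>
    hj x (by rw [hC0 x hx (j x d), map_zero])
  by_cases hP : (M.supp ∩ Preds H (S ∪ T)).Finite
  · refine Or.inl (hq.fpres_mid (fpres_of_finite_supp _ (hP.subset ?_)) hD)
    rintro x ⟨a, ha⟩
    refine ⟨⟨i x a, fun h' => ha (hq.inj x (h'.trans (map_zero _).symm))⟩, ?_⟩
    by_contra hx
    exact ha (hK0 x hx a)
  by_cases hP' : (M.supp ∩ Succs H (S ∪ T)).Finite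
  · refine Or.inr (hq.dual.fpres_mid (dual_fpres_of_finite_supp _ (hP'.subset ?_)) hK)
    rintro x ⟨d, hd⟩
    obtain ⟨m, rfl⟩ := hq.surj x d
    refine ⟨⟨m, fun h' => hd (by rw [h', map_zero])⟩, ?_⟩
    by_contra hx
    exact hd (hD0 x hx _)
  refine (he.false_of_infinite hM (hS.union hT) hC0 (fun x hx => h1 x fun h' => hx (.inl h'))
    (fun x y α hx hy => LinearMap.ext fun m => ?_) hP hP').elim
  obtain ⟨a, ha⟩ := hq.exact y (M.map α m) (by rw [hq.hom_p, hD0 x hx (q x m), map_zero])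
  rw [← ha, hK0 y hy a, map_zero]
  rfl

theorem Irr.fpres_or_dual_fpres_of_inj {M N₁ N₂ : QRep k H} {f₁ : Fam M N₁} {f₂ : Fam M N₂}
    (hf : Irr (pair f₁ f₂)) (h₁ : Irr f₁) (h₂ : Irr f₂) (hM : Loc M) (hN₂ : Loc N₂)
    (hi : ∀ x, Function.Injective (pair f₁ f₂ x)) (hi₁ : ∀ x, Function.Injective (f₁ x)) :
    M.FPres ∨ M.dual.FPres := by
  have hs := ses_coker hf.hom hi
  have hs₁ := ses_coker h₁.hom hi₁
  obtain ⟨i, q, hiq⟩ := ses_coker_pair hs hs₁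
  have hN : N₂.FPres := hiq.fpres_left (hf.fpres hs hM.topFin) (h₁.fpres hs₁ hM.topFin)
  rcases h₂.inj_or_surj with hi₂ | hs₂
  · have hs₂ := ses_coker h₂.hom hi₂
    exact Or.inl (hs₂.fpres_left hN (h₂.fpres hs₂ hM.topFin))
  · have hk := ses_ker h₂.hom hs₂
    exact hf.fpres_or_dual_fpres hs hM hk (h₂.dual_fpres hk hN₂.dual.topFin) hN hiq.inj

/-- The middle term of a large irreducible morphism into a sum of two representations starts at
a finitely presented or at a finitely copresented representation. -/
theorem Irr.fpres_or_dual_fpres_of_pair {M N₁ N₂ : QRep k H} {f₁ : Fam M N₁} {f₂ : Fam M N₂}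
    (hf : Irr (pair f₁ f₂)) (h₁ : Irr f₁) (h₂ : Irr f₂) (hM : Loc M) (hN₁ : Loc N₁)
    (hN₂ : Loc N₂) : M.FPres ∨ M.dual.FPres := by
  rcases hf.inj_or_surj with hi | hs
  · rcases h₁.inj_or_surj with hi₁ | hs₁
    · exact hf.fpres_or_dual_fpres_of_inj h₁ h₂ hM hN₂ hi hi₁
    rcases h₂.inj_or_surj with hi₂ | hs₂
    · refine hf.pair_swap.fpres_or_dual_fpres_of_inj h₂ h₁ hM hN₁ (fun x m m' hm => hi x ?_) hi₂
      exact Prod.ext (congrArg Prod.snd hm) (congrArg Prod.fst hm)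
    · have hs := ses_coker hf.hom hi
      obtain ⟨i, q, hiq⟩ := ses_kernels hs h₁.hom h₂.hom hs₁ hs₂
      have hk₁ := h₁.dual_fpres (ses_ker h₁.hom hs₁) hN₁.dual.topFin
      have hk₂ := h₂.dual_fpres (ses_ker h₂.hom hs₂) hN₂.dual.topFin
      exact hf.fpres_or_dual_fpres hs hM hiq ((ses_prd _ _).dual.fpres_mid hk₂ hk₁)
        (hf.fpres hs hM.topFin) (j := idf _) fun _ => Function.injective_id
  · have hs₁ : ∀ x, Function.Surjective (f₁ x) := fun x n => by
      obtain ⟨m, hm⟩ := hs x (n, 0)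
      exact ⟨m, congrArg Prod.fst hm⟩
    have hs₂ : ∀ x, Function.Surjective (f₂ x) := fun x n => by
      obtain ⟨m, hm⟩ := hs x (0, n)
      exact ⟨m, congrArg Prod.snd hm⟩
    obtain ⟨i, q, hiq⟩ := ses_ker_pair hf.hom h₂.hom hs
    have hk := hf.dual_fpres (ses_ker hf.hom hs) (hN₁.dual.topFin.dual_prd hN₂.dual.topFin)
    have hk₁ := h₁.dual_fpres (ses_ker h₁.hom hs₁) hN₁.dual.topFin
    have hk₂ := h₂.dual_fpres (ses_ker h₂.hom hs₂) hN₂.dual.topFin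
    exact Or.inr ((ses_ker h₁.hom hs₁).dual.fpres_mid (hiq.dual.fpres_left hk₂ hk) hk₁)

end QRep

end Assembly

section Pairs

namespace QRep

variable {k : Type} [Field k] {V : Type} {H : V → V → Type}

theorem splitMono_of_cmp_injective {M N : QRep k H} {f : Fam M N} {r : Fam N M} (hf : IsHom f)
    (hr : IsHom r) (h : ∀ x m, r x (f x m) = 0 → m = 0) : SplitMono f := by
  obtain ⟨w, hw, hw1, -⟩ := exists_inverse (hr.cmp hf) (bijective_of_injective (cmp r f) h)
  exact ⟨cmp w r, hw.cmp hr, hw1⟩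

theorem Loc.splitMono_or {M N₁ N₂ : QRep k H} (hM : Loc M) {f₁ : Fam M N₁} {f₂ : Fam M N₂}
    (h₁ : IsHom f₁) (h₂ : IsHom f₂) (h : SplitMono (pair f₁ f₂)) :
    SplitMono f₁ ∨ SplitMono f₂ := by
  obtain ⟨r, hr, hr'⟩ := h
  let r₁ : Fam N₁ M := fun x => r x ∘ₗ LinearMap.inl k _ _
  let r₂ : Fam N₂ M := fun x => r x ∘ₗ LinearMap.inr k _ _
  have hr₁ : IsHom r₁ := fun x y α n => by
    refine Eq.trans (congrArg (r y) ?_) (hr α ((n, 0) : _ × N₂.X x))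
    exact Prod.ext rfl (map_zero (N₂.map α)).symm
  have hr₂ : IsHom r₂ := fun x y α n => by
    refine Eq.trans (congrArg (r y) ?_) (hr α ((0, n) : N₁.X x × _))
    exact Prod.ext (map_zero (N₁.map α)).symm rfl
  have hsum : ∀ x m, r₁ x (f₁ x m) + r₂ x (f₂ x m) = m := fun x m => by
    refine Eq.trans ((map_add (r x) _ _).symm.trans (congrArg (r x) ?_)) (hr' x m)
    exact Prod.ext (add_zero _) (zero_add _)
  refine (hM (cmp r₁ f₁) (hr₁.cmp h₁)).imp (splitMono_of_cmp_injective h₁ hr₁) fun h =>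
    splitMono_of_cmp_injective h₂ hr₂ fun x m hm => h x m ?_
  have := hsum x m
  rwa [hm, add_zero] at this

theorem Irr.left_of_pair {M N₁ N₂ : QRep k H} {f₁ : Fam M N₁} {f₂ : Fam M N₂}
    (hf : Irr (pair f₁ f₂)) (hM : Loc M) (hN : ∃ x, ∃ n : N₁.X x, n ≠ 0) : Irr f₁ := by
  have h₁ : IsHom f₁ := fun x y α m => congrArg Prod.fst (hf.hom α m)
  have h₂ : IsHom f₂ := fun x y α m => congrArg Prod.snd (hf.hom α m)
  have hm₁ : ¬ SplitMono f₁ := fun ⟨r, hr, hr'⟩ =>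
    hf.not_mono ⟨cmp r (fstF N₁ N₂), hr.cmp (isHom_fst _ _), hr'⟩
  have hm₂ : ¬ SplitMono f₂ := fun ⟨r, hr, hr'⟩ =>
    hf.not_mono ⟨cmp r (sndF N₁ N₂), hr.cmp (isHom_snd _ _), hr'⟩
  refine ⟨h₁, hm₁, ?_, fun X g h hg hh hgh => ?_⟩
  · rintro ⟨s, hs, hs'⟩
    rcases hM (cmp s f₁) (hs.cmp h₁) with hi | hi
    · exact hm₁ (splitMono_of_cmp_injective h₁ hs hi)
    · obtain ⟨x, n, hn⟩ := hN
      have h0 : s x n = 0 := hi x (s x n) (congrArg (s x) (hs' x n))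
      exact hn (by rw [← hs' x n, h0, map_zero])
  · let h' : Fam (X.prd N₂) (N₁.prd N₂) := pair (cmp h (fstF _ _)) (sndF _ _)
    rcases hf.factor (X.prd N₂) (pair g f₂) h' (hg.pair h₂)
      ((hh.cmp (isHom_fst _ _)).pair (isHom_snd _ _))
      (fun x m => Prod.ext (hgh x m) rfl) with hs | ⟨s, hs, hs'⟩
    · exact Or.inl ((hM.splitMono_or hg h₂ hs).resolve_right hm₂)
    · refine Or.inr ⟨fun x => LinearMap.fst k _ _ ∘ₗ s x ∘ₗ LinearMap.inl k _ _,
        fun x y α n => ?_, fun x n => congrArg Prod.fst (hs' x (n, 0))⟩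
      refine congrArg Prod.fst (Eq.trans (congrArg (s y) ?_) (hs α ((n, 0) : _ × N₂.X x)))
      exact Prod.ext rfl (map_zero (N₂.map α)).symm

theorem Irr.pair {M N₁ N₂ : QRep k H} {f₁ : Fam M N₁} {f₂ : Fam M N₂} (h₁ : Irr f₁) (h₂ : Irr f₂)
    (hM : Loc M) (hN₁ : Loc N₁) (hN₂ : Loc N₂)
    (hne : ¬ ∃ φ : Fam N₂ N₁, IsHom φ ∧ ∀ x, Function.Bijective (φ x)) :
    Irr (QRep.pair f₁ f₂) := by
  refine ⟨h₁.hom.pair h₂.hom, fun hs => ?_, ?_, fun X g h hg hh hgh => ?_⟩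
  · exact (hM.splitMono_or h₁.hom h₂.hom hs).elim h₁.not_mono h₂.not_mono
  · rintro ⟨s, hs, hs'⟩
    refine h₁.not_epi ⟨fun x => s x ∘ₗ LinearMap.inl k _ _, fun x y α n => ?_,
      fun x n => congrArg Prod.fst (hs' x (n, 0))⟩
    refine Eq.trans (congrArg (s y) ?_) (hs α ((n, 0) : _ × N₂.X x))
    exact Prod.ext rfl (map_zero (N₂.map α)).symm
  let p₁ : Fam X N₁ := QRep.cmp (fstF _ _) h
  let p₂ : Fam X N₂ := QRep.cmp (sndF _ _) h
  have hp₁ : IsHom p₁ := (isHom_fst _ _).cmp hh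
  have hp₂ : IsHom p₂ := (isHom_snd _ _).cmp hh
  rcases h₁.factor X g p₁ hg hp₁ (fun x m => congrArg Prod.fst (hgh x m)) with hm | ⟨s₁, hs₁, e₁⟩
  · exact Or.inl hm
  rcases h₂.factor X g p₂ hg hp₂ (fun x m => congrArg Prod.snd (hgh x m)) with hm | ⟨s₂, hs₂, e₂⟩
  · exact Or.inl hm
  right
  let a : Fam N₂ N₁ := QRep.cmp p₁ s₂
  let b : Fam N₁ N₂ := QRep.cmp p₂ s₁
  have ha : IsHom a := hp₁.cmp hs₂
  have hb : IsHom b := hp₂.cmp hs₁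
  rcases hN₁ (QRep.cmp a b) (ha.cmp hb) with hi | hi
  · exfalso
    have hbij := bijective_of_injective (QRep.cmp a b) hi
    obtain ⟨w, hw, hw1, hw2⟩ := exists_inverse (ha.cmp hb) hbij
    rcases hN₂ (QRep.cmp b (QRep.cmp w a)) (hb.cmp (hw.cmp ha)) with hj | hj
    · refine hne ⟨a, ha, fun x => ⟨(injective_iff_map_eq_zero _).2 fun n hn => hj x n ?_,
        fun n => ⟨_, hw2 x n⟩⟩⟩
      change b x (w x (a x n)) = 0
      rw [hn, map_zero, map_zero]
    · refine h₁.not_epi ⟨fun _ => 0, fun x y α n => (map_zero (M.map α)).symm, fun x n => ?_⟩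
      have hb0 : b x n = 0 := hj x (b x n) (congrArg (b x) (hw1 x n))
      have hn : n = 0 := hi x n (by rw [LinearMap.comp_apply, hb0, map_zero])
      rw [hn, map_zero, map_zero]
  · have hD := (isHom_id N₁).sub (ha.cmp hb)
    obtain ⟨w, hw, hw1, hw2⟩ := exists_inverse hD (bijective_of_injective _ fun x m hm =>
      hi x m (sub_eq_zero.1 hm).symm)
    let t₁ : Fam N₁ X := QRep.cmp (fun x => s₁ x - QRep.cmp s₂ b x) w
    have ht₁ : IsHom t₁ := (hs₁.sub (hs₂.cmp hb)).cmp hw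
    let t₂ : Fam N₂ X := fun x => s₂ x - QRep.cmp t₁ a x
    have ht₂ : IsHom t₂ := hs₂.sub (ht₁.cmp ha)
    have h11 : ∀ x n, p₁ x (t₁ x n) = n := fun x n => by
      refine Eq.trans ?_ (hw2 x n)
      refine (map_sub (p₁ x) _ _).trans ?_
      rw [e₁]
      rfl
    have h12 : ∀ x n, p₂ x (t₁ x n) = 0 := fun x n => by
      refine (map_sub (p₂ x) _ _).trans (sub_eq_zero.2 ?_)
      exact (e₂ x (b x (w x n))).symm
    have h21 : ∀ x n, p₁ x (t₂ x n) = 0 := fun x n => by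
      refine (map_sub (p₁ x) _ _).trans (sub_eq_zero.2 ?_)
      exact (h11 x (a x n)).symm
    have h22 : ∀ x n, p₂ x (t₂ x n) = n := fun x n => by
      refine (map_sub (p₂ x) _ _).trans ?_
      refine (congrArg₂ (· - ·) (e₂ x n) (h12 x (a x n))).trans (sub_zero n)
    refine ⟨fun x => (t₁ x).coprod (t₂ x), fun x y α n => ?_, fun x n => ?_⟩
    · change t₁ y (N₁.map α n.1) + t₂ y (N₂.map α n.2) = X.map α (t₁ x n.1 + t₂ x n.2)
      rw [ht₁ α, ht₂ α, map_add]
    · refine (map_add (h x) _ _).trans (Prod.ext ?_ ?_)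
      · exact (congrArg₂ (· + ·) (h11 x n.1) (h21 x n.2)).trans (add_zero _)
      · exact (congrArg₂ (· + ·) (h12 x n.1) (h22 x n.2)).trans (zero_add _)

/-- Two irreducible morphisms starting at `M` have isomorphic targets. -/
theorem Irr.exists_bijective [SLF H] {M N₁ N₂ : QRep k H} {f₁ : Fam M N₁} {f₂ : Fam M N₂}
    (h₁ : Irr f₁) (h₂ : Irr f₂) (hM : Loc M) (hN₁ : Loc N₁) (hN₂ : Loc N₂) (hp : ¬ M.FPres)
    (hp' : ¬ M.dual.FPres) : ∃ φ : Fam N₂ N₁, IsHom φ ∧ ∀ x, Function.Bijective (φ x) := by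
  by_contra hne
  exact ((h₁.pair h₂ hM hN₁ hN₂ hne).fpres_or_dual_fpres_of_pair h₁ h₂ hM hN₁ hN₂).elim hp hp'

theorem not_irr_pair [SLF H] {M N : QRep k H} (hM : Loc M) (hN : Loc N)
    (hN' : ∃ x, ∃ n : N.X x, n ≠ 0) (hp : ¬ M.FPres) (hp' : ¬ M.dual.FPres) (f₁ f₂ : Fam M N) :
    ¬ Irr (pair f₁ f₂) := fun hf =>
  (hf.fpres_or_dual_fpres_of_pair (hf.left_of_pair hM hN') (hf.pair_swap.left_of_pair hM hN')
    hM hN hN).elim hp hp'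

end QRep

end Pairs

section Translation

variable {k : Type} [Field k] {Q : Type} [Quiver.{0} Q]

variable (Q) in
/-- The arrows of a quiver. -/
abbrev Arr : Q → Q → Type := fun x y => x ⟶ y

/-- A path, as a path for the family of arrows. -/
def toPth {x : Q} : ∀ {y : Q}, Quiver.Path x y → Pth (Arr Q) x y
  | _, .nil => .nil
  | _, .cons p α => .cons (toPth p) α

/-- A path for the family of arrows, as a path. -/
def ofPth {x : Q} : ∀ {y : Q}, Pth (Arr Q) x y → Quiver.Path x y
  | _, .nil => .nil
  | _, .cons p α => .cons (ofPth p) α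

/-- The two notions of path agree. -/
def pthEquiv (x y : Q) : Pth (Arr Q) x y ≃ Quiver.Path x y where
  toFun := ofPth
  invFun := toPth
  left_inv p := by
    induction p with
    | nil => rfl
    | cons p α ih => exact congrArg (fun q => Pth.cons q α) ih
  right_inv p := by
    induction p with
    | nil => rfl
    | cons p α ih => exact congrArg (fun q => Quiver.Path.cons q α) ih

theorem slf_arr (hQ : StronglyLocallyFinite Q) : SLF (Arr Q) where
  out x := (hQ.1 x).1
  inn x := (hQ.1 x).2
  path x y :=
    have := hQ.2 x y
    Finite.of_equiv _ (pthEquiv x y).symm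

variable (k) in
/-- A path, as a morphism of the path category. -/
noncomputable def pathHom {x y : Q} (p : Quiver.Path x y) : vtx k Q x ⟶ vtx k Q y :=
  (Free.embedding k (Paths Q)).map (X := x) (Y := y) p

theorem pathHom_nil (x : Q) : pathHom k (Quiver.Path.nil : Quiver.Path x x) = 𝟙 _ :=
  (Free.embedding k (Paths Q)).map_id x

theorem pathHom_cons {x y z : Q} (p : Quiver.Path x y) (α : y ⟶ z) :
    pathHom k (p.cons α) = pathHom k p ≫ arrHom k Q α :=
  (Free.embedding k (Paths Q)).map_comp (X := x) (Y := y) (Z := z) p α.toPath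

variable (k) in
/-- The morphisms of the path category, as linear combinations of paths. -/
noncomputable def homEquiv (x y : Q) : (Quiver.Path x y →₀ k) ≃ₗ[k] (vtx k Q x ⟶ vtx k Q y) where
  toFun f := f
  invFun f := f
  map_add' _ _ := rfl
  map_smul' _ _ := rfl

theorem homEquiv_single {x y : Q} (p : Quiver.Path x y) :
    homEquiv k x y (Finsupp.single p 1) = pathHom k p := rfl

theorem hom_induction {x y : Q} {C : (vtx k Q x ⟶ vtx k Q y) → Prop} (h0 : C 0)
    (hadd : ∀ f g, C f → C g → C (f + g)) (hsmul : ∀ (r : k) p, C (r • pathHom k p))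
    (f : vtx k Q x ⟶ vtx k Q y) : C f := by
  obtain ⟨v, rfl⟩ := (homEquiv k x y).surjective f
  induction v using Finsupp.induction_linear with
  | zero => rwa [map_zero]
  | add v w hv hw =>
    rw [map_add]
    exact hadd _ _ hv hw
  | single p r =>
    have h := hsmul r p
    rwa [← homEquiv_single, ← map_smul, Finsupp.smul_single, smul_eq_mul, mul_one] at h

theorem IsMod.map_zero {M : PathCat k Q ⥤ ModuleCat.{0} k} (hM : IsMod k M) {a b : PathCat k Q} :
    M.map (0 : a ⟶ b) = 0 := by
  have h := hM.2 (0 : k) (0 : a ⟶ b)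
  rwa [zero_smul, zero_smul] at h

theorem natural_pathHom {M N : PathCat k Q ⥤ ModuleCat.{0} k}
    (φ : ∀ x : Q, M.obj (vtx k Q x) ⟶ N.obj (vtx k Q x))
    (hφ : ∀ ⦃x y : Q⦄ (α : x ⟶ y), M.map (arrHom k Q α) ≫ φ y = φ x ≫ N.map (arrHom k Q α))
    {x y : Q} (p : Quiver.Path x y) : M.map (pathHom k p) ≫ φ y = φ x ≫ N.map (pathHom k p) := by
  induction p with
  | nil => rw [pathHom_nil, M.map_id, N.map_id, Category.id_comp, Category.comp_id]
  | cons p α ih =>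
    have h1 : M.map (pathHom k (p.cons α)) = M.map (pathHom k p) ≫ M.map (arrHom k Q α) := by
      rw [pathHom_cons, M.map_comp]
    have h2 : N.map (pathHom k (p.cons α)) = N.map (pathHom k p) ≫ N.map (arrHom k Q α) := by
      rw [pathHom_cons, N.map_comp]
    rw [h1, h2, Category.assoc, hφ, ← Category.assoc, ih, Category.assoc]

theorem natural_hom {M N : PathCat k Q ⥤ ModuleCat.{0} k} (hM : IsMod k M) (hN : IsMod k N)
    (φ : ∀ x : Q, M.obj (vtx k Q x) ⟶ N.obj (vtx k Q x))
    (hφ : ∀ ⦃x y : Q⦄ (α : x ⟶ y), M.map (arrHom k Q α) ≫ φ y = φ x ≫ N.map (arrHom k Q α))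
    {x y : Q} (f : vtx k Q x ⟶ vtx k Q y) : M.map f ≫ φ y = φ x ≫ N.map f := by
  revert f
  refine hom_induction ?_ ?_ ?_
  · rw [hM.map_zero, hN.map_zero, zero_comp, comp_zero]
  · intro f g hf hg
    rw [hM.1, hN.1, Preadditive.add_comp, Preadditive.comp_add, hf, hg]
  · intro r p
    rw [hM.2, hN.2, Linear.smul_comp, Linear.comp_smul, natural_pathHom φ hφ p]

/-- The natural transformation given by a family of linear maps compatible with the arrows. -/
def toNat {M N : PathCat k Q ⥤ ModuleCat.{0} k} (hM : IsMod k M) (hN : IsMod k N)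
    (φ : ∀ x : Q, M.obj (vtx k Q x) ⟶ N.obj (vtx k Q x))
    (hφ : ∀ ⦃x y : Q⦄ (α : x ⟶ y), M.map (arrHom k Q α) ≫ φ y = φ x ≫ N.map (arrHom k Q α)) :
    M ⟶ N where
  app x := φ x
  naturality x y f := natural_hom hM hN φ hφ (x := x) (y := y) f

namespace QRep

/-- The action of a path on the values of a representation. -/
def pathMap (X : QRep k (Arr Q)) {x : Q} : ∀ {y : Q}, Quiver.Path x y → (X.X x →ₗ[k] X.X y)
  | _, .nil => LinearMap.id
  | _, .cons p α => X.map α ∘ₗ pathMap X p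

theorem pathMap_comp (X : QRep k (Arr Q)) {x y z : Q} (p : Quiver.Path x y)
    (q : Quiver.Path y z) : X.pathMap (p.comp q) = X.pathMap q ∘ₗ X.pathMap p := by
  induction q with
  | nil => rfl
  | cons q α ih => exact congrArg (fun t => X.map α ∘ₗ t) ih

/-- The action of a morphism of the path category on the values of a representation. -/
noncomputable def homMap (X : QRep k (Arr Q)) (x y : Q) :
    (vtx k Q x ⟶ vtx k Q y) →ₗ[k] (X.X x →ₗ[k] X.X y) :=
  Finsupp.linearCombination k X.pathMap ∘ₗ (homEquiv k x y).symm.toLinearMap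

theorem homMap_pathHom (X : QRep k (Arr Q)) {x y : Q} (p : Quiver.Path x y) :
    X.homMap x y (pathHom k p) = X.pathMap p := by
  rw [← homEquiv_single]
  simp [homMap]

theorem pathHom_comp {x y z : Q} (p : Quiver.Path x y) (q : Quiver.Path y z) :
    pathHom k p ≫ pathHom k q = pathHom k (p.comp q) :=
  ((Free.embedding k (Paths Q)).map_comp (X := x) (Y := y) (Z := z) p q).symm

theorem homMap_comp (X : QRep k (Arr Q)) {x y z : Q} (f : vtx k Q x ⟶ vtx k Q y)
    (g : vtx k Q y ⟶ vtx k Q z) : X.homMap x z (f ≫ g) = X.homMap y z g ∘ₗ X.homMap x y f := by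
  revert f
  refine hom_induction ?_ ?_ ?_
  · rw [zero_comp, map_zero, map_zero, LinearMap.comp_zero]
  · intro f f' hf hf'
    rw [Preadditive.add_comp, map_add, map_add, LinearMap.comp_add, hf, hf']
  · intro r p
    rw [Linear.smul_comp, map_smul, map_smul, LinearMap.comp_smul]
    congr 1
    revert g
    refine hom_induction ?_ ?_ ?_
    · rw [comp_zero, map_zero, map_zero, LinearMap.zero_comp]
    · intro g g' hg hg'
      rw [Preadditive.comp_add, map_add, map_add, LinearMap.add_comp, hg, hg']
    · intro s q
      rw [Linear.comp_smul, map_smul, map_smul, LinearMap.smul_comp, pathHom_comp,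
        homMap_pathHom, homMap_pathHom, homMap_pathHom, pathMap_comp]

/-- The value of a representation, as an object of the category of vector spaces. -/
abbrev objAt (X : QRep k (Arr Q)) (x : Q) : ModuleCat.{0} k := ModuleCat.of k (X.X x)

/-- The action of a morphism of the path category, as a morphism of vector spaces. -/
noncomputable abbrev mapAt (X : QRep k (Arr Q)) {x y : Q} (f : vtx k Q x ⟶ vtx k Q y) :
    X.objAt x ⟶ X.objAt y := ModuleCat.ofHom (X.homMap x y f)

theorem mapAt_id (X : QRep k (Arr Q)) (x : Q) : X.mapAt (𝟙 (vtx k Q x)) = 𝟙 _ := by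
  rw [← pathHom_nil, mapAt, homMap_pathHom]
  rfl

theorem mapAt_comp (X : QRep k (Arr Q)) {x y z : Q} (f : vtx k Q x ⟶ vtx k Q y)
    (g : vtx k Q y ⟶ vtx k Q z) : X.mapAt (f ≫ g) = X.mapAt f ≫ X.mapAt g :=
  congrArg ModuleCat.ofHom (X.homMap_comp f g)

/-- The functor given by a representation. -/
noncomputable def toFunctor (X : QRep k (Arr Q)) : PathCat k Q ⥤ ModuleCat.{0} k where
  obj x := X.objAt x
  map {x y} f := X.mapAt (x := x) (y := y) f
  map_id x := X.mapAt_id x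
  map_comp {x y z} f g := X.mapAt_comp (x := x) (y := y) (z := z) f g

theorem mapAt_add (X : QRep k (Arr Q)) {x y : Q} (f g : vtx k Q x ⟶ vtx k Q y) :
    X.mapAt (f + g) = X.mapAt f + X.mapAt g :=
  congrArg ModuleCat.ofHom (map_add (X.homMap x y) f g)

theorem mapAt_smul (X : QRep k (Arr Q)) {x y : Q} (r : k) (f : vtx k Q x ⟶ vtx k Q y) :
    X.mapAt (r • f) = r • X.mapAt f :=
  congrArg ModuleCat.ofHom (map_smul (X.homMap x y) r f)

theorem isLfdMod_toFunctor (X : QRep k (Arr Q)) : IsLfdMod k X.toFunctor :=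
  ⟨⟨fun {a b} f g => X.mapAt_add (x := a) (y := b) f g,
    fun {a b} r f => X.mapAt_smul (x := a) (y := b) r f⟩, fun x => QRep.fin (V := Q) X x⟩

theorem mapAt_arrHom (X : QRep k (Arr Q)) {x y : Q} (α : x ⟶ y) :
    X.mapAt (arrHom k Q α) = ModuleCat.ofHom (X.map α) :=
  congrArg ModuleCat.ofHom (X.homMap_pathHom α.toPath)

end QRep

end Translation

section Dictionary

open QRep

variable {k : Type} [Field k] {Q : Type} [Quiver.{0} Q]
variable {L M N : PathCat k Q ⥤ ModuleCat.{0} k}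

/-- The representation given by a module over the path category. -/
noncomputable abbrev rep (M : PathCat k Q ⥤ ModuleCat.{0} k) (hM : IsLfdMod k M) : QRep k (Arr Q) where
  X x := M.obj (vtx k Q x)
  fin x := hM.2 (vtx k Q x)
  map α := (M.map (arrHom k Q α)).hom

/-- The family of linear maps underlying a natural transformation. -/
noncomputable abbrev fam (hM : IsLfdMod k M) (hN : IsLfdMod k N) (f : M ⟶ N) : Fam (rep M hM) (rep N hN) :=
  fun x => (f.app (vtx k Q x)).hom

theorem app_map_apply {A : Type} [Category.{0} A] {M N : A ⥤ ModuleCat.{0} k} (f : M ⟶ N)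
    {a b : A} (u : a ⟶ b) (m : M.obj a) :
    f.app b (M.map u m) = N.map u (f.app a m) :=
  congrArg (fun g => g.hom m) (f.naturality u)

theorem isHom_fam (hM : IsLfdMod k M) (hN : IsLfdMod k N) (f : M ⟶ N) : IsHom (fam hM hN f) :=
  fun _ _ α m => app_map_apply f (arrHom k Q α) m

/-- The natural transformation given by a morphism of representations. -/
noncomputable def ofFam (hM : IsLfdMod k M) (hN : IsLfdMod k N) (φ : Fam (rep M hM) (rep N hN)) (hφ : IsHom φ) :
    M ⟶ N :=
  toNat hM.1 hN.1 (fun x => ModuleCat.ofHom (φ x)) fun _ _ α =>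
    ModuleCat.hom_ext (LinearMap.ext fun m => hφ α m)

theorem nat_ext {f g : M ⟶ N} (h : ∀ (x : Q) (m : M.obj (vtx k Q x)),
    f.app (vtx k Q x) m = g.app (vtx k Q x) m) : f = g :=
  NatTrans.ext (funext fun x => ModuleCat.hom_ext (LinearMap.ext fun m => h x m))

theorem splitMono_of_isSplitMono (hM : IsLfdMod k M) (hN : IsLfdMod k N) (f : M ⟶ N)
    (h : IsSplitMono f) : SplitMono (fam hM hN f) :=
  ⟨fam hN hM (retraction f), isHom_fam _ _ _, fun x m =>
    congrArg (fun g : M ⟶ M => g.app (vtx k Q x) m) (IsSplitMono.id f)⟩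

theorem isSplitMono_of_splitMono (hM : IsLfdMod k M) (hN : IsLfdMod k N) (f : M ⟶ N)
    (h : SplitMono (fam hM hN f)) : IsSplitMono f := by
  obtain ⟨r, hr, h⟩ := h
  exact ⟨⟨⟨ofFam hN hM r hr, nat_ext fun x m => h x m⟩⟩⟩

theorem splitEpi_of_isSplitEpi (hM : IsLfdMod k M) (hN : IsLfdMod k N) (f : M ⟶ N)
    (h : IsSplitEpi f) : SplitEpi (fam hM hN f) :=
  ⟨fam hN hM (section_ f), isHom_fam _ _ _, fun x m =>
    congrArg (fun g : N ⟶ N => g.app (vtx k Q x) m) (IsSplitEpi.id f)⟩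

theorem isSplitEpi_of_splitEpi (hM : IsLfdMod k M) (hN : IsLfdMod k N) (f : M ⟶ N)
    (h : SplitEpi (fam hM hN f)) : IsSplitEpi f := by
  obtain ⟨s, hs, h⟩ := h
  exact ⟨⟨⟨ofFam hN hM s hs, nat_ext fun x m => h x m⟩⟩⟩

/-- The comparison of a representation with the one of its functor. -/
noncomputable abbrev toRep (X : QRep k (Arr Q)) : Fam X (rep X.toFunctor X.isLfdMod_toFunctor) :=
  fun _ => LinearMap.id

/-- The comparison of the representation of a functor of a representation with the latter. -/
noncomputable abbrev ofRep (X : QRep k (Arr Q)) : Fam (rep X.toFunctor X.isLfdMod_toFunctor) X :=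
  fun _ => LinearMap.id

theorem isHom_toRep (X : QRep k (Arr Q)) : IsHom (toRep X) := fun _ _ α m =>
  (congrArg (fun g => g.hom m) (X.mapAt_arrHom α)).symm

theorem isHom_ofRep (X : QRep k (Arr Q)) : IsHom (ofRep X) := fun _ _ α m =>
  congrArg (fun g => g.hom m) (X.mapAt_arrHom α)

theorem Irred.irr (hM : IsLfdMod k M) (hN : IsLfdMod k N) {f : M ⟶ N} (hf : Irred k f) :
    Irr (fam hM hN f) where
  hom := isHom_fam _ _ _
  not_mono h := hf.1 (isSplitMono_of_splitMono hM hN f h)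
  not_epi h := hf.2.1 (isSplitEpi_of_splitEpi hM hN f h)
  factor X g h hg hh hgh := by
    have hX := X.isLfdMod_toFunctor
    have hg' := (isHom_toRep X).cmp hg
    have hh' := hh.cmp (isHom_ofRep X)
    rcases hf.2.2 hX (ofFam hM hX _ hg') (ofFam hX hN _ hh') (nat_ext fun x m => hgh x m)
      with h1 | h1
    · obtain ⟨r, hr, h2⟩ := splitMono_of_isSplitMono hM hX _ h1
      exact .inl ⟨cmp r (toRep X), hr.cmp (isHom_toRep X), h2⟩
    · obtain ⟨s, hs, h2⟩ := splitEpi_of_isSplitEpi hX hN _ h1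
      exact .inr ⟨cmp (ofRep X) s, (isHom_ofRep X).cmp hs, h2⟩

theorem isLfdMod_of_injective {A : Type} [Category.{0} A] [Preadditive A]
    [CategoryTheory.Linear k A] {ι : Type} [Finite ι] {K : A ⥤ ModuleCat.{0} k}
    {N : ι → A ⥤ ModuleCat.{0} k} (hN : ∀ i, IsLfdMod k (N i)) (π : ∀ i, K ⟶ N i)
    (h : ∀ a (m : K.obj a), (∀ i, (π i).app a m = 0) → m = 0) : IsLfdMod k K := by
  have h' : ∀ a (m n : K.obj a), (∀ i, (π i).app a m = (π i).app a n) → m = n := fun a m n hmn =>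
    sub_eq_zero.1 (h a _ fun i => by rw [map_sub, hmn, sub_self])
  refine ⟨⟨fun {a b} f g => ?_, fun {a b} r f => ?_⟩, fun a => ?_⟩
  · refine ModuleCat.hom_ext (LinearMap.ext fun m => h' _ _ _ fun i => ?_)
    change (π i).app b (K.map (f + g) m) = (π i).app b (K.map f m + K.map g m)
    rw [map_add, app_map_apply, app_map_apply, app_map_apply, (hN i).1.1]
    rfl
  · refine ModuleCat.hom_ext (LinearMap.ext fun m => h' _ _ _ fun i => ?_)
    change (π i).app b (K.map (r • f) m) = (π i).app b (r • K.map f m)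
    rw [map_smul, app_map_apply, app_map_apply, (hN i).1.2]
    rfl
  · have := fun i => (hN i).2 a
    exact FiniteDimensional.of_injective (LinearMap.pi fun i => ((π i).app a).hom)
      fun m n hmn => h' a m n fun i => congrFun hmn i

theorem isLfdMod_of_surjective {A : Type} [Category.{0} A] [Preadditive A]
    [CategoryTheory.Linear k A] {K N : A ⥤ ModuleCat.{0} k} (hK : IsLfdMod k K) (π : K ⟶ N)
    (h : ∀ a, Function.Surjective ((π.app a).hom)) : IsLfdMod k N := by
  refine ⟨⟨fun {a b} f g => ?_, fun {a b} r f => ?_⟩, fun a => ?_⟩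
  · refine ModuleCat.hom_ext (LinearMap.ext fun n => ?_)
    obtain ⟨m, rfl⟩ := h a n
    change N.map (f + g) (π.app a m) = N.map f (π.app a m) + N.map g (π.app a m)
    rw [← app_map_apply, ← app_map_apply, ← app_map_apply, hK.1.1, ← map_add]
    rfl
  · refine ModuleCat.hom_ext (LinearMap.ext fun n => ?_)
    obtain ⟨m, rfl⟩ := h a n
    change N.map (r • f) (π.app a m) = r • N.map f (π.app a m)
    rw [← app_map_apply, ← app_map_apply, hK.1.2, ← map_smul]
    rfl
  · have := hK.2 a
    exact Module.Finite.of_surjective _ (h a)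

theorem biprod_total {A : Type} [Category.{0} A] {X Y : A ⥤ ModuleCat.{0} k} (a : A)
    (z : (X ⊞ Y).obj a) : (biprod.inl : X ⟶ X ⊞ Y).app a ((biprod.fst : X ⊞ Y ⟶ X).app a z) +
      (biprod.inr : Y ⟶ X ⊞ Y).app a ((biprod.snd : X ⊞ Y ⟶ Y).app a z) = z :=
  congrArg (fun g : X ⊞ Y ⟶ X ⊞ Y => g.app a z) biprod.total

theorem biprod_eq_zero {A : Type} [Category.{0} A] {X Y : A ⥤ ModuleCat.{0} k} (a : A)
    (z : (X ⊞ Y).obj a) (h1 : (biprod.fst : X ⊞ Y ⟶ X).app a z = 0)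
    (h2 : (biprod.snd : X ⊞ Y ⟶ Y).app a z = 0) : z = 0 := by
  rw [← biprod_total a z, h1, h2, map_zero, map_zero, add_zero]

theorem isLfdMod_biprod (hM : IsLfdMod k M) (hN : IsLfdMod k N) : IsLfdMod k (M ⊞ N) :=
  isLfdMod_of_injective (ι := Bool) (N := fun i => if i then M else N)
    (fun i => by cases i <;> assumption)
    (fun i => match i with
      | true => (biprod.fst : M ⊞ N ⟶ M)
      | false => (biprod.snd : M ⊞ N ⟶ N))
    fun a m h => biprod_eq_zero a m (h true) (h false)

/-- The comparison of the representation of a biproduct with the product. -/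
theorem biprod_bijective (hM : IsLfdMod k M) (hN : IsLfdMod k N) (x : Q) :
    Function.Bijective (pair (fam (isLfdMod_biprod hM hN) hM biprod.fst)
      (fam (isLfdMod_biprod hM hN) hN biprod.snd) x) := by
  refine ⟨(injective_iff_map_eq_zero _).2 fun z hz => biprod_eq_zero _ z (congrArg Prod.fst hz)
    (congrArg Prod.snd hz), fun ⟨m, n⟩ => ⟨(biprod.lift (𝟙 M) 0 : M ⟶ M ⊞ N).app _ m +
      (biprod.lift 0 (𝟙 N) : N ⟶ M ⊞ N).app _ n, ?_⟩⟩
  have h1 : ∀ {A B : PathCat k Q ⥤ ModuleCat.{0} k} {f g : A ⟶ B} (_ : f = g) (z : A.obj (vtx k Q x)),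
    f.app _ z = g.app _ z := fun h z => by rw [h]
  refine Prod.ext ?_ ?_
  · change (biprod.fst : M ⊞ N ⟶ M).app _ (_ + _) = m
    rw [map_add]
    refine (congrArg₂ _ (h1 (biprod.lift_fst (𝟙 M) (0 : M ⟶ N)) m)
      (h1 (biprod.lift_fst (0 : N ⟶ M) (𝟙 N)) n)).trans (add_zero m)
  · change (biprod.snd : M ⊞ N ⟶ N).app _ (_ + _) = n
    rw [map_add]
    refine (congrArg₂ _ (h1 (biprod.lift_snd (𝟙 M) (0 : M ⟶ N)) m)
      (h1 (biprod.lift_snd (0 : N ⟶ M) (𝟙 N)) n)).trans (zero_add n)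

theorem Indec.exists_ne_zero (hM : Indec k M) : ∃ (x : Q) (m : M.obj (vtx k Q x)), m ≠ 0 := by
  by_contra! h
  exact hM.1 ((IsZero.iff_id_eq_zero _).2 (nat_ext fun x m => by rw [h x m, map_zero, map_zero]))

theorem eq_zero_of_isZero (h : IsZero M) {x : PathCat k Q} (m : M.obj x) : m = 0 :=
  congrArg (fun g : M ⟶ M => g.app x m) ((IsZero.iff_id_eq_zero _).1 h)

theorem isIso_of_bijective (hM : IsLfdMod k M) (hN : IsLfdMod k N)
    {φ : Fam (rep M hM) (rep N hN)} (hφ : IsHom φ) (hb : ∀ x, Function.Bijective (φ x)) :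
    Nonempty (M ≅ N) := by
  obtain ⟨ψ, hψ, h1, h2⟩ := exists_inverse hφ hb
  exact ⟨⟨ofFam hM hN φ hφ, ofFam hN hM ψ hψ, nat_ext fun x m => h1 x m, nat_ext fun x m => h2 x m⟩⟩

theorem Indec.eq_bot_or_eq_bot (hM : IsLfdMod k M) (hi : Indec k M)
    {U W : ∀ x, Submodule k ((rep M hM).X x)} (hU : (rep M hM).Stable U)
    (hW : (rep M hM).Stable W) (hc : ∀ x, IsCompl (U x) (W x)) :
    (∀ x, U x = ⊥) ∨ ∀ x, W x = ⊥ := by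
  set X := (rep M hM).sub U hU
  set Y := (rep M hM).sub W hW
  have hX := X.isLfdMod_toFunctor
  have hY := Y.isLfdMod_toFunctor
  have hXY := isLfdMod_biprod hX hY
  let φ : Fam (rep (X.toFunctor ⊞ Y.toFunctor) hXY) (rep M hM) :=
    fun x => (U x).subtype ∘ₗ ofRep X x ∘ₗ fam hXY hX biprod.fst x +
      (W x).subtype ∘ₗ ofRep Y x ∘ₗ fam hXY hY biprod.snd x
  have hφ : IsHom φ :=
    ((isHom_subι _ U hU).cmp ((isHom_ofRep X).cmp (isHom_fam hXY hX biprod.fst))).add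
      ((isHom_subι _ W hW).cmp ((isHom_ofRep Y).cmp (isHom_fam hXY hY biprod.snd)))
  have hb : ∀ x, Function.Bijective (φ x) := by
    intro x
    have h1 := biprod_bijective hX hY x
    have h2 := (Submodule.prodEquivOfIsCompl (U x) (W x) (hc x)).bijective
    exact h2.comp h1
  obtain ⟨e⟩ := isIso_of_bijective hXY hM hφ hb
  rcases hi.2 hX hY e.symm with h | h
  · exact .inl fun x => (Submodule.eq_bot_iff _).2 fun m hm =>
      congrArg Subtype.val (eq_zero_of_isZero h (x := vtx k Q x) (⟨m, hm⟩ : U x))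
  · exact .inr fun x => (Submodule.eq_bot_iff _).2 fun m hm =>
      congrArg Subtype.val (eq_zero_of_isZero h (x := vtx k Q x) (⟨m, hm⟩ : W x))

theorem Indec.loc (hM : IsLfdMod k M) (hi : Indec k M) : Loc (rep M hM) := by
  intro θ hθ
  have hpow : ∀ n, IsHom (M := rep M hM) (N := rep M hM) fun x => θ x ^ n := by
    intro n
    induction n with
    | zero => exact isHom_id _
    | succ n ih =>
      intro x y α m
      simp only [pow_succ]
      exact (congrArg (θ y ^ n) (hθ α m)).trans (ih α _)
  have hmem : ∀ x m, m ∈ (⨆ n, LinearMap.ker (θ x ^ n)) ↔ ∃ n, (θ x ^ n) m = 0 := by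
    intro x m
    have hd : Directed (· ≤ ·) fun n => LinearMap.ker (θ x ^ n) :=
      (LinearMap.iterateKer (θ x)).monotone.directed_le
    rw [Submodule.mem_iSup_of_directed _ hd]
    rfl
  have hc : ∀ x, IsCompl (⨆ n, LinearMap.ker (θ x ^ n)) (⨅ n, LinearMap.range (θ x ^ n)) :=
    fun x =>
      have : FiniteDimensional k (M.obj (vtx k Q x)) := hM.2 _
      LinearMap.isCompl_iSup_ker_pow_iInf_range_pow (θ x)
  rcases hi.eq_bot_or_eq_bot hM (U := fun x => ⨆ n, LinearMap.ker (θ x ^ n))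
    (W := fun x => ⨅ n, LinearMap.range (θ x ^ n)) (fun x y α m hm => by
      obtain ⟨n, hn⟩ := (hmem x m).1 hm
      refine (hmem y _).2 ⟨n, ?_⟩
      exact (hpow n α m).trans ((congrArg _ hn).trans (map_zero _)))
    (fun x y α m hm => by
      rw [Submodule.mem_iInf] at hm ⊢
      intro n
      obtain ⟨m', rfl⟩ := hm n
      exact ⟨_, hpow n α m'⟩) hc with h | h
  · refine .inl fun x m hm => ?_
    have : m ∈ (⨆ n, LinearMap.ker (θ x ^ n)) := (hmem x m).2 ⟨1, by rwa [pow_one]⟩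
    rw [h x] at this
    exact this
  · refine .inr fun x m hm => ?_
    have h1 := (hc x).codisjoint.eq_top
    have h2 := h x
    dsimp only at h2
    rw [h2, sup_bot_eq] at h1
    obtain ⟨n, hn⟩ := (hmem x m).1 (h1 ▸ Submodule.mem_top)
    have : ∀ n, (θ x ^ n) m = m := by
      intro n
      induction n with
      | zero => rfl
      | succ n ih => rw [pow_succ, Module.End.mul_apply, hm, ih]
    rw [← this n, hn]

end Dictionary

section Presentations

open QRep

namespace QRep

variable {k : Type} [Field k] {V : Type} {H : V → V → Type}

theorem GenBy.exists_elements {M : QRep k H} {S : Set V} (hS : S.Finite) (h : M.GenBy S) :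
    ∃ (r : ℕ) (a : Fin r → V) (m : ∀ i, M.X (a i)),
      ∀ U, M.Stable U → (∀ i, m i ∈ U (a i)) → ∀ x, U x = ⊤ := by
  have := hS.to_subtype
  let ι := Σ s : S, Fin (Module.finrank k (M.X s))
  obtain ⟨r, ⟨e⟩⟩ := Finite.exists_equiv_fin ι
  refine ⟨r, fun i => (e.symm i).1, fun i => Module.finBasis k _ (e.symm i).2, fun U hU hm =>
    h U hU fun s hs => ?_⟩
  have h1 : ∀ z : ι, Module.finBasis k _ z.2 ∈ U z.1 := e.symm.surjective.forall.2 hm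
  rw [eq_top_iff, ← (Module.finBasis k (M.X s)).span_eq, Submodule.span_le]
  rintro _ ⟨j, rfl⟩
  exact h1 ⟨⟨s, hs⟩, j⟩

theorem FPres.exists_elements [SLF H] {M : QRep k H} (h : M.FPres) :
    ∃ (r : ℕ) (a : Fin r → V) (m : ∀ i, M.X (a i)),
      ∀ U, M.Stable U → (∀ i, m i ∈ U (a i)) → ∀ x, U x = ⊤ := by
  obtain ⟨S, hS, h0, h1⟩ := h
  exact (genBy_of_surjective hS h0 fun x hx => (h1 x hx).2).exists_elements hS

theorem fpres_dual_pi [SLF H] {ι : Type} [Finite ι] (M : ι → QRep k H)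
    (h : ∀ i, (M i).dual.FPres) : (piRep M).dual.FPres := by
  classical
  have := Fintype.ofFinite ι
  refine (fpres_pi _ h).of_bijective
    (φ := fun x => (LinearMap.lsum k (fun i => (M i).X x) k).toLinearMap) ?_
    fun x => (LinearMap.lsum k (fun i => (M i).X x) k).bijective
  intro x y α ξ
  apply LinearMap.ext
  intro m
  simp [LinearMap.lsum_apply, LinearMap.sum_apply]

theorem dualF_bijective {M N : QRep k H} {φ : Fam M N} (hb : ∀ x, Function.Bijective (φ x)) (x : V) :
    Function.Bijective (dualF φ x) :=
  (LinearEquiv.ofBijective (φ x) (hb x)).dualMap.bijective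

end QRep

section Functors

variable {k : Type} [Field k] {A : Type} [Category.{0} A]
  {r : ℕ} (F : Fin r → A ⥤ ModuleCat.{0} k)

theorem biproduct_total (a : A) (z : (⨁ F).obj a) :
    ∑ i, (biproduct.ι F i).app a ((biproduct.π F i).app a z) = z := by
  have h : ((∑ i, biproduct.π F i ≫ biproduct.ι F i : ⨁ F ⟶ ⨁ F).app a).hom z = z :=
    congrArg (fun g : ⨁ F ⟶ ⨁ F => (g.app a).hom z) (biproduct.total (f := F))
  rw [NatTrans.app_sum, ModuleCat.hom_sum, LinearMap.sum_apply] at h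
  exact h

theorem biproduct_eq_zero (a : A) (z : (⨁ F).obj a) (h : ∀ i, (biproduct.π F i).app a z = 0) :
    z = 0 := by
  rw [← biproduct_total F a z]
  exact Finset.sum_eq_zero fun i _ => by rw [h i, map_zero]

theorem biproduct_surjective (a : A) (m : ∀ i, (F i).obj a) :
    ∃ z : (⨁ F).obj a, ∀ i, (biproduct.π F i).app a z = m i := by
  refine ⟨∑ i, (biproduct.ι F i).app a (m i), fun j => ?_⟩
  rw [map_sum, Finset.sum_eq_single j]
  · exact congrArg (fun g : F j ⟶ F j => g.app a (m j)) (biproduct.ι_π_self F j)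
  · intro i _ hi
    exact congrArg (fun g : F i ⟶ F j => g.app a (m i)) (biproduct.ι_π_ne F hi)
  · simp

variable {F}

theorem isLfdMod_biproduct [Preadditive A] [CategoryTheory.Linear k A]
    (hF : ∀ i, IsLfdMod k (F i)) : IsLfdMod k (⨁ F) :=
  isLfdMod_of_injective hF (biproduct.π F) (biproduct_eq_zero F)

theorem app_injective {M N : A ⥤ ModuleCat.{0} k} (f : M ⟶ N) [Mono f] (a : A) :
    Function.Injective (f.app a) :=
  (ModuleCat.mono_iff_injective _).1 ((NatTrans.mono_iff_mono_app f).1 inferInstance a)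

theorem app_surjective {M N : A ⥤ ModuleCat.{0} k} (f : M ⟶ N) [Epi f] (a : A) :
    Function.Surjective (f.app a) :=
  (ModuleCat.epi_iff_surjective _).1 ((NatTrans.epi_iff_epi_app f).1 inferInstance a)

variable [Preadditive A] [CategoryTheory.Linear k A]

/-- The morphism from a projective module attached to an element. -/
noncomputable def yon {M : A ⥤ ModuleCat.{0} k} (hM : IsMod k M) {a : A} (m : M.obj a) :
    ProjAt k a ⟶ M where
  app b := ModuleCat.ofHom
    { toFun := fun f : a ⟶ b => M.map f m
      map_add' := fun f g => by rw [hM.1]; rfl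
      map_smul' := fun r f => by rw [hM.2]; rfl }
  naturality b c g := ModuleCat.hom_ext (LinearMap.ext fun f : a ⟶ b =>
    congrArg (fun h => h.hom m) (M.map_comp f g))

/-- The morphism to an injective module attached to a functional. -/
noncomputable def coyon {M : A ⥤ ModuleCat.{0} k} (hM : IsMod k M) {a : A}
    (ξ : Module.Dual k (M.obj a)) : M ⟶ InjAt k a where
  app b := ModuleCat.ofHom
    { toFun := fun m =>
        { toFun := fun f : b ⟶ a => ξ (M.map f m)
          map_add' := fun f g => by rw [hM.1, ← map_add]; rfl
          map_smul' := fun r f => by rw [hM.2, RingHom.id_apply, ← map_smul]; rfl }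
      map_add' := fun m n => LinearMap.ext fun f => by
        change ξ (M.map f (m + n)) = ξ (M.map f m) + ξ (M.map f n)
        rw [map_add, map_add]
      map_smul' := fun r m => LinearMap.ext fun f => by
        change ξ (M.map f (r • m)) = r • ξ (M.map f m)
        rw [map_smul, map_smul] }
  naturality b c g := ModuleCat.hom_ext (LinearMap.ext fun m => LinearMap.ext fun f : c ⟶ a =>
    congrArg (fun h => ξ (h.hom m)) (M.map_comp g f).symm)

theorem isLfdMod_projAt (a : A) (h : ∀ b : A, FiniteDimensional k (a ⟶ b)) :
    IsLfdMod k (ProjAt k a) :=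
  ⟨⟨fun f g => ModuleCat.hom_ext (LinearMap.ext fun u => Preadditive.comp_add _ _ _ u f g),
    fun r f => ModuleCat.hom_ext (LinearMap.ext fun u => Linear.comp_smul _ _ _ u r f)⟩, h⟩

theorem isLfdMod_injAt (a : A) (h : ∀ b : A, FiniteDimensional k (b ⟶ a)) :
    IsLfdMod k (InjAt k a) :=
  ⟨⟨fun {b c} f g => ModuleCat.hom_ext (LinearMap.ext fun u : Module.Dual k (b ⟶ a) =>
      LinearMap.ext fun v : c ⟶ a =>
        (congrArg (fun z => u z) (Preadditive.add_comp _ _ _ f g v)).trans (map_add u _ _)),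
    fun {b c} r f => ModuleCat.hom_ext (LinearMap.ext fun u : Module.Dual k (b ⟶ a) =>
      LinearMap.ext fun v : c ⟶ a =>
        (congrArg (fun z => u z) (Linear.smul_comp _ _ _ r f v)).trans (map_smul u _ _))⟩,
    fun b => have := h b; inferInstanceAs (FiniteDimensional k (Module.Dual k (b ⟶ a)))⟩

end Functors

variable {k : Type} [Field k] {Q : Type} [Quiver.{0} Q] [SLF (Arr Q)]
variable {M N : PathCat k Q ⥤ ModuleCat.{0} k}

/-- The linear combinations of paths, as morphisms of the path category. -/
noncomputable def pthHomEquiv (x y : Q) : (Pth (Arr Q) x y →₀ k) ≃ₗ[k] (vtx k Q x ⟶ vtx k Q y) :=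
  (Finsupp.domLCongr (pthEquiv x y)).trans (homEquiv k x y)

omit [SLF (Arr Q)] in
theorem pthHomEquiv_single {x y : Q} (p : Pth (Arr Q) x y) :
    pthHomEquiv x y (Finsupp.single p (1 : k)) = pathHom k (ofPth p) := by
  rw [pthHomEquiv, LinearEquiv.trans_apply, Finsupp.domLCongr_single, homEquiv_single]
  rfl

theorem finiteDimensional_hom (x y : Q) : FiniteDimensional k (vtx k Q x ⟶ vtx k Q y) :=
  Module.Finite.equiv (pthHomEquiv x y)

theorem isLfdMod_proj (x : Q) : IsLfdMod k (ProjAt k (vtx k Q x)) :=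
  isLfdMod_projAt _ fun y => finiteDimensional_hom (Q := Q) x y

theorem isLfdMod_inj (x : Q) : IsLfdMod k (InjAt k (vtx k Q x)) :=
  isLfdMod_injAt _ fun y => finiteDimensional_hom (Q := Q) y x

theorem act_projAt {x y : Q} (p : Pth (Arr Q) x y) :
    (rep _ (isLfdMod_proj (k := k) x)).act (𝟙 (vtx k Q x)) p = pathHom k (ofPth p) := by
  induction p with
  | nil => exact (pathHom_nil x).symm
  | cons p α ih =>
    change (rep _ (isLfdMod_proj (k := k) x)).map α (QRep.act _ _ p) = _
    rw [ih]
    exact (pathHom_cons (ofPth p) α).symm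

theorem fpres_projAt (x : Q) : (rep _ (isLfdMod_proj (k := k) x)).FPres := by
  refine (fpres_proj k (Arr Q) x).of_bijective (isHom_ofElem _ (𝟙 (vtx k Q x))) fun y => ?_
  have h : ofElem (rep _ (isLfdMod_proj (k := k) x)) (𝟙 (vtx k Q x)) y =
      (pthHomEquiv x y).toLinearMap := by
    refine Finsupp.lhom_ext' fun p => LinearMap.ext_ring ?_
    refine (ofElem_single _ _ p (1 : k)).trans ?_
    rw [one_smul, act_projAt]
    exact (pthHomEquiv_single p).symm
  rw [h]
  exact (pthHomEquiv x y).bijective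

omit [SLF (Arr Q)] in
theorem pathHom_pre {x y z : Q} (α : x ⟶ y) (q : Pth (Arr Q) y z) :
    pathHom k (ofPth (Pth.pre (H := Arr Q) α q)) = arrHom k Q α ≫ pathHom k (ofPth q) := by
  induction q with
  | nil =>
    refine (pathHom_cons (k := k) Quiver.Path.nil α).trans ?_
    refine Eq.trans ?_ (congrArg (fun t => arrHom k Q α ≫ t) (pathHom_nil (k := k) y)).symm
    rw [pathHom_nil, Category.id_comp, Category.comp_id]
  | cons q β ih =>
    refine (pathHom_cons (ofPth (Pth.pre (H := Arr Q) α q)) β).trans ?_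
    rw [ih, Category.assoc]
    exact congrArg (fun t => arrHom k Q α ≫ t) (pathHom_cons (k := k) (ofPth q) β).symm

theorem act_dual_injAt {x y : Q} (p : Pth (Opp (Arr Q)) x y) :
    (rep _ (isLfdMod_inj (k := k) x)).dual.act
      (Module.Dual.eval k (vtx k Q x ⟶ vtx k Q x) (𝟙 (vtx k Q x))) p =
      Module.Dual.eval k (vtx k Q y ⟶ vtx k Q x)
        (pathHom k (ofPth (Pth.rev (H := Opp (Arr Q)) p))) := by
  induction p with
  | nil => exact congrArg (Module.Dual.eval k _) (pathHom_nil (k := k) x).symm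
  | cons p α ih =>
    change (rep _ (isLfdMod_inj (k := k) x)).dual.map α (QRep.act _ _ p) = _
    rw [ih]
    exact congrArg (Module.Dual.eval k _) (pathHom_pre (k := k) (show _ ⟶ _ from α)
      (Pth.rev (H := Opp (Arr Q)) p)).symm

theorem fpres_dual_injAt (x : Q) : (rep _ (isLfdMod_inj (k := k) x)).dual.FPres := by
  refine (fpres_proj k (Opp (Arr Q)) x).of_bijective (isHom_ofElem _
    (Module.Dual.eval k (vtx k Q x ⟶ vtx k Q x) (𝟙 (vtx k Q x)))) fun y => ?_
  have := finiteDimensional_hom (k := k) y x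
  let e : (Pth (Opp (Arr Q)) x y →₀ k) ≃ₗ[k] Module.Dual k (Module.Dual k (vtx k Q y ⟶ vtx k Q x)) :=
    (Finsupp.domLCongr (Pth.revEquiv (H := Opp (Arr Q)) x y)).trans
      ((pthHomEquiv y x).trans (Module.evalEquiv k _))
  have h : ofElem (rep _ (isLfdMod_inj (k := k) x)).dual
      (Module.Dual.eval k (vtx k Q x ⟶ vtx k Q x) (𝟙 (vtx k Q x))) y = e.toLinearMap := by
    refine Finsupp.lhom_ext' fun p => LinearMap.ext_ring ?_
    refine (ofElem_single _ _ p (1 : k)).trans ?_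
    rw [one_smul, act_dual_injAt]
    have h1 : e (Finsupp.single p (1 : k)) = Module.Dual.eval k (vtx k Q y ⟶ vtx k Q x)
        (pthHomEquiv y x (Finsupp.domLCongr (Pth.revEquiv (H := Opp (Arr Q)) x y)
          (Finsupp.single p (1 : k)))) := rfl
    refine Eq.trans ?_ h1.symm
    rw [Finsupp.domLCongr_single, pthHomEquiv_single]
    rfl
  rw [h]
  exact e.bijective

section Biproduct

variable {r : ℕ} {F : Fin r → PathCat k Q ⥤ ModuleCat.{0} k} (hF : ∀ i, IsLfdMod k (F i))

/-- The comparison of the representation of a biproduct with the product. -/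
noncomputable abbrev biproductFam :
    Fam (rep (⨁ F) (isLfdMod_biproduct hF)) (piRep fun i => rep (F i) (hF i)) :=
  fun x => LinearMap.pi fun i => fam (isLfdMod_biproduct hF) (hF i) (biproduct.π F i) x

omit [SLF (Arr Q)] in
theorem isHom_biproductFam : IsHom (biproductFam hF) := fun _ _ α m =>
  funext fun i => isHom_fam (isLfdMod_biproduct hF) (hF i) (biproduct.π F i) α m

omit [SLF (Arr Q)] in
theorem biproductFam_bijective (x : Q) : Function.Bijective (biproductFam hF x) := by
  refine ⟨(injective_iff_map_eq_zero _).2 fun z hz =>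
    biproduct_eq_zero F _ z fun i => congrFun hz i, fun m => ?_⟩
  obtain ⟨z, hz⟩ := biproduct_surjective F (vtx k Q x) m
  exact ⟨z, funext hz⟩

theorem fpres_biproduct (h : ∀ i, (rep (F i) (hF i)).FPres) :
    (rep (⨁ F) (isLfdMod_biproduct hF)).FPres := by
  obtain ⟨ψ, hψ, h1, h2⟩ := exists_inverse (isHom_biproductFam hF) (biproductFam_bijective hF)
  exact (fpres_pi _ h).of_bijective hψ fun x => Function.bijective_iff_has_inverse.2
    ⟨_, h2 x, h1 x⟩

theorem fpres_dual_biproduct (h : ∀ i, (rep (F i) (hF i)).dual.FPres) :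
    (rep (⨁ F) (isLfdMod_biproduct hF)).dual.FPres :=
  (fpres_dual_pi _ h).of_bijective (isHom_biproductFam hF).dual
    (dualF_bijective (biproductFam_bijective hF))

end Biproduct

omit [SLF (Arr Q)] in
theorem isLfdMod_kernel (hM : IsLfdMod k M) (f : M ⟶ N) : IsLfdMod k (kernel f) :=
  isLfdMod_of_injective (ι := Unit) (fun _ => hM) (fun _ => kernel.ι f) fun a _ h =>
    app_injective (kernel.ι f) a ((h ()).trans (map_zero _).symm)

omit [SLF (Arr Q)] in
theorem isLfdMod_cokernel (hN : IsLfdMod k N) (f : M ⟶ N) : IsLfdMod k (cokernel f) :=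
  isLfdMod_of_surjective hN (cokernel.π f) fun a => app_surjective (cokernel.π f) a

omit [SLF (Arr Q)] in
theorem ses_kernel (hM : IsLfdMod k M) (hN : IsLfdMod k N) (f : M ⟶ N) [Epi f] :
    SES (fam (isLfdMod_kernel hM f) hM (kernel.ι f)) (fam hM hN f) where
  hom_i := isHom_fam _ _ _
  hom_p := isHom_fam _ _ _
  inj x := app_injective (kernel.ι f) _
  surj x := app_surjective f _
  zero x a := congrArg (fun g : kernel f ⟶ N => (g.app (vtx k Q x)).hom a) (kernel.condition f)
  exact x b hb := by
    have hφ := isHom_fam hM hN f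
    set X := (rep M hM).sub _ hφ.stable_ker
    have hX := X.isLfdMod_toFunctor
    let g : X.toFunctor ⟶ M :=
      ofFam hX hM _ ((isHom_subι _ _ hφ.stable_ker).cmp (isHom_ofRep X))
    have hg : g ≫ f = 0 := nat_ext fun y m => m.2
    exact ⟨(kernel.lift f g hg).app (vtx k Q x) (⟨b, hb⟩ : kerF (fam hM hN f) x),
      congrArg (fun h : X.toFunctor ⟶ M => (h.app (vtx k Q x)).hom
        (⟨b, hb⟩ : kerF (fam hM hN f) x)) (kernel.lift_ι f g hg)⟩

omit [SLF (Arr Q)] in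
theorem ses_cokernel (hM : IsLfdMod k M) (hN : IsLfdMod k N) (f : M ⟶ N) [Mono f] :
    SES (fam hM hN f) (fam hN (isLfdMod_cokernel hN f) (cokernel.π f)) where
  hom_i := isHom_fam _ _ _
  hom_p := isHom_fam _ _ _
  inj x := app_injective f _
  surj x := app_surjective (cokernel.π f) _
  zero x a := congrArg (fun g : M ⟶ cokernel f => (g.app (vtx k Q x)).hom a)
    (cokernel.condition f)
  exact x b hb := by
    have hφ := isHom_fam hM hN f
    set X := (rep N hN).quo _ hφ.stable_ran
    have hX := X.isLfdMod_toFunctor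
    let g : N ⟶ X.toFunctor :=
      ofFam hN hX _ ((isHom_toRep X).cmp (isHom_quoπ _ _ hφ.stable_ran))
    have hg : f ≫ g = 0 := nat_ext fun y m => (Submodule.Quotient.mk_eq_zero _).2 ⟨m, rfl⟩
    have h1 : (g.app (vtx k Q x)).hom b = 0 := by
      rw [← cokernel.π_desc f g hg]
      exact (congrArg ((cokernel.desc f g hg).app (vtx k Q x)).hom hb).trans (map_zero _)
    exact (Submodule.Quotient.mk_eq_zero _).1 h1

theorem exists_epi (hM : IsLfdMod k M) (h : (rep M hM).FPres) :
    ∃ (r : ℕ) (a : Fin r → Q) (f : (⨁ fun i => ProjAt k (vtx k Q (a i))) ⟶ M), Epi f := by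
  obtain ⟨r, a, m, hm⟩ := h.exists_elements
  have hP : ∀ i, IsLfdMod k (ProjAt k (vtx k Q (a i))) := fun i => isLfdMod_proj (a i)
  let f : (⨁ fun i => ProjAt k (vtx k Q (a i))) ⟶ M := biproduct.desc fun i => yon hM.1 (m i)
  have hf := hm _ (isHom_fam (isLfdMod_biproduct hP) hM f).stable_ran fun i =>
    ⟨(biproduct.ι (fun i => ProjAt k (vtx k Q (a i))) i).app (vtx k Q (a i))
      (𝟙 (vtx k Q (a i))), by
      have h1 := biproduct.ι_desc (f := fun i => ProjAt k (vtx k Q (a i)))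
        (fun i => yon hM.1 (m i)) i
      refine (congrArg (fun g : ProjAt k (vtx k Q (a i)) ⟶ M =>
        (g.app (vtx k Q (a i))).hom (𝟙 (vtx k Q (a i)))) h1).trans ?_
      exact congrArg (fun g => g.hom (m i)) (M.map_id (vtx k Q (a i)))⟩
  refine ⟨r, a, f, ?_⟩
  have : ∀ x, Epi (f.app x) := fun x =>
    (ModuleCat.epi_iff_surjective _).2 (LinearMap.range_eq_top.1 (hf x))
  exact NatTrans.epi_of_epi_app f

theorem exists_mono (hM : IsLfdMod k M) (h : (rep M hM).dual.FPres) :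
    ∃ (r : ℕ) (a : Fin r → Q) (f : M ⟶ ⨁ fun i => InjAt k (vtx k Q (a i))), Mono f := by
  obtain ⟨r, a, ξ, hξ⟩ := h.exists_elements
  have hI : ∀ i, IsLfdMod k (InjAt k (vtx k Q (a i))) := fun i => isLfdMod_inj (a i)
  let f : M ⟶ ⨁ fun i => InjAt k (vtx k Q (a i)) := biproduct.lift fun i => coyon hM.1 (ξ i)
  have hφ := isHom_fam hM (isLfdMod_biproduct hI) f
  have hf := hξ (fun x => (kerF (fam hM (isLfdMod_biproduct hI) f) x).dualAnnihilator)
    (fun x y α η hη => by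
      rw [Submodule.mem_dualAnnihilator] at hη ⊢
      exact fun m hm => hη _ (hφ.stable_ker (show y ⟶ x from α) m hm)) (fun i => by
      rw [Submodule.mem_dualAnnihilator]
      intro m hm
      have h1 := biproduct.lift_π (f := fun i => InjAt k (vtx k Q (a i)))
        (fun i => coyon hM.1 (ξ i)) i
      have h2 : (coyon hM.1 (ξ i)).app (vtx k Q (a i)) m = 0 := by
        rw [← h1]
        exact (congrArg ((biproduct.π (fun i => InjAt k (vtx k Q (a i))) i).app
          (vtx k Q (a i))).hom hm).trans (map_zero _)
      have h3 : ξ i (M.map (𝟙 (vtx k Q (a i))) m) = 0 :=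
        congrArg (fun η : Module.Dual k (vtx k Q (a i) ⟶ vtx k Q (a i)) => η (𝟙 _)) h2
      rwa [M.map_id] at h3)
  refine ⟨r, a, f, ?_⟩
  have : ∀ x : Q, Mono (f.app (vtx k Q x)) := fun x =>
    (ModuleCat.mono_iff_injective _).2 ((injective_iff_map_eq_zero _).2 fun m hm => by
      refine eq_of_dual (M := rep M hM) (x := x) fun η => ?_
      have h1 : η ∈ (kerF (fam hM (isLfdMod_biproduct hI) f) x).dualAnnihilator := by
        rw [hf x]
        exact Submodule.mem_top
      rw [(Submodule.mem_dualAnnihilator _).1 h1 m hm, map_zero])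
  have : ∀ x, Mono (f.app x) := this
  exact NatTrans.mono_of_mono_app f

theorem isFP_of_fpres (hM : IsLfdMod k M) (h : (rep M hM).FPres) : IsFP k M := by
  obtain ⟨r, a, f, hf⟩ := exists_epi hM h
  have hP : ∀ i, IsLfdMod k (ProjAt k (vtx k Q (a i))) := fun i => isLfdMod_proj (a i)
  have h1 := fpres_biproduct hP fun i => fpres_projAt (a i)
  have h2 := (ses_kernel (isLfdMod_biproduct hP) hM f).fpres_left h1 h
  obtain ⟨s, b, g, hg⟩ := exists_epi _ h2
  exact ⟨r, fun i => vtx k Q (a i), f, hf, s, fun i => vtx k Q (b i), g, hg⟩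

theorem isFCP_of_fpres_dual (hM : IsLfdMod k M) (h : (rep M hM).dual.FPres) : IsFCP k M := by
  obtain ⟨r, a, f, hf⟩ := exists_mono hM h
  have hI : ∀ i, IsLfdMod k (InjAt k (vtx k Q (a i))) := fun i => isLfdMod_inj (a i)
  have h1 := fpres_dual_biproduct hI fun i => fpres_dual_injAt (a i)
  have h2 := (ses_cokernel hM (isLfdMod_biproduct hI) f).dual.fpres_left h1 h
  obtain ⟨s, b, g, hg⟩ := exists_mono _ h2
  exact ⟨r, fun i => vtx k Q (a i), f, hf, s, fun i => vtx k Q (b i), g, hg⟩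

end Presentations

variable (k : Type) [Field k] [IsAlgClosed k]
variable (Q : Type) [Quiver.{0} Q]

/-- Let `M` be indecomposable in `rep(Q)`, neither finitely presented nor finitely
co-presented. Then any two indecomposables admitting an irreducible morphism from `M` are
isomorphic, and there is no irreducible morphism `M ⟶ N ⊕ N` with `N` indecomposable. -/
theorem statement_15 (hQ : StronglyLocallyFinite Q)
    (M : PathCat k Q ⥤ ModuleCat.{0} k) (hM : IsLfdMod k M) (hind : Indec k M)
    (hnfp : ¬ IsFP k M) (hnfcp : ¬ IsFCP k M) :
    (∀ N₁ N₂ : PathCat k Q ⥤ ModuleCat.{0} k,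
        IsLfdMod k N₁ → Indec k N₁ → IsLfdMod k N₂ → Indec k N₂ →
        (∃ f₁ : M ⟶ N₁, Irred k f₁) → (∃ f₂ : M ⟶ N₂, Irred k f₂) →
        Nonempty (N₁ ≅ N₂)) ∧
      (∀ N : PathCat k Q ⥤ ModuleCat.{0} k, IsLfdMod k N → Indec k N →
        ¬ ∃ f : M ⟶ N ⊞ N, Irred k f) := by
  have : SLF (Arr Q) := slf_arr hQ
  have hp : ¬ (rep M hM).FPres := fun h => hnfp (isFP_of_fpres hM h)
  have hp' : ¬ (rep M hM).dual.FPres := fun h => hnfcp (isFCP_of_fpres_dual hM h)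
  refine ⟨?_, ?_⟩
  · rintro N₁ N₂ hN₁ hi₁ hN₂ hi₂ ⟨f₁, hf₁⟩ ⟨f₂, hf₂⟩
    obtain ⟨φ, hφ, hb⟩ := (hf₁.irr hM hN₁).exists_bijective (hf₂.irr hM hN₂) (hind.loc hM)
      (hi₁.loc hN₁) (hi₂.loc hN₂) hp hp'
    obtain ⟨e⟩ := isIso_of_bijective hN₂ hN₁ hφ hb
    exact ⟨e.symm⟩
  · rintro N hN hi ⟨f, hf⟩
    have hNN := isLfdMod_biprod hN hN
    exact QRep.not_irr_pair (hind.loc hM) (hi.loc hN) hi.exists_ne_zero hp hp'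
      (QRep.cmp (fam hNN hN biprod.fst) (fam hM hNN f))
      (QRep.cmp (fam hNN hN biprod.snd) (fam hM hNN f))
      ((hf.irr hM hNN).comp_bijective
        ((isHom_fam hNN hN biprod.fst).pair (isHom_fam hNN hN biprod.snd))
        (biprod_bijective hN hN))


end Paper
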